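/- arXiv:math/0008235 — 2 statements merged into one kernel-verified Lean document; each statement's English description precedes it below -/
import Mathlib

section
/- (Combing decomposition P_{m,n} = F_{m+n−1} ⋊ P_{m,n−1}) Let n ≥ 2, let F denote the subgroup of B_{m+n} generated by a_{1,m+n}, …, a_{m+n−1,m+n}, let ι : B_{m+n−1} → B_{m+n} be the homomorphism determined by σ_k ↦ σ_k, and let H = ι(P_{m,n−1}) be the image under ι of the subgroup P_{m,n−1} of B_{m+n−1}. Then every element A of P_{m,n} can be written in exactly one way as a product A = u · h with u ∈ F and h ∈ H. -/
open FreeGroup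

namespace BraidPaper

/-- Relators for the Artin braid group on generators `σ_1, …, σ_n`
(so this presents the braid group `B_{n+1}`); the generator with index `k : Fin n`
represents `σ_{k+1}`. -/
def braidRels (n : ℕ) : Set (FreeGroup (Fin n)) :=
  {x | ∃ k l : Fin n, ((k : ℕ) + 2 ≤ (l : ℕ) ∨ (l : ℕ) + 2 ≤ (k : ℕ)) ∧
      x = of k * of l * (of k)⁻¹ * (of l)⁻¹} ∪
  {x | ∃ k l : Fin n, (l : ℕ) = (k : ℕ) + 1 ∧
      x = of k * of l * of k * (of l)⁻¹ * (of k)⁻¹ * (of l)⁻¹}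

/-- The braid group with `n` generators `σ_1, …, σ_n`, i.e. the Artin braid group
`B_{n+1}`.  Thus `B_N = BraidGroup (N-1)`. -/
abbrev BraidGroup (n : ℕ) : Type := PresentedGroup (braidRels n)

/-- The generator `σ_k` (1-based) of `BraidGroup n`, for `1 ≤ k ≤ n`. -/
def sgen (n k : ℕ) : BraidGroup n :=
  if h : 1 ≤ k ∧ k ≤ n then PresentedGroup.of ⟨k - 1, by omega⟩ else 1

/-- The descending product `σ_{j-1} σ_{j-2} ⋯ σ_{i+1}`. -/
def dprod (n i j : ℕ) : BraidGroup n :=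
  ((List.range (j - 1 - i)).map fun t => sgen n (j - 1 - t)).prod

/-- The pure braid generator
`a_{ij} = σ_{j-1} σ_{j-2} ⋯ σ_{i+1} σ_i² σ_{i+1}⁻¹ ⋯ σ_{j-2}⁻¹ σ_{j-1}⁻¹`. -/
def agen (n i j : ℕ) : BraidGroup n := dprod n i j * (sgen n i) ^ 2 * (dprod n i j)⁻¹
/-- The generating set of the mixed braid group `B_{m,n} ≤ B_{m+n}`:
the pure generators `a_{ij}` with `1 ≤ i < j`, `m+1 ≤ j ≤ m+n`, together with
the crossings `σ_{m+1}, …, σ_{m+n-1}` among the last `n` strands. -/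
def BmnSet (m n : ℕ) : Set (BraidGroup (m + n - 1)) :=
  {x | ∃ i j : ℕ, 1 ≤ i ∧ i < j ∧ m + 1 ≤ j ∧ j ≤ m + n ∧ x = agen (m + n - 1) i j} ∪
  {x | ∃ k : ℕ, m + 1 ≤ k ∧ k ≤ m + n - 1 ∧ x = sgen (m + n - 1) k}

/-- The mixed braid group `B_{m,n}`, as a subgroup of `B_{m+n}`. -/
def Bmn (m n : ℕ) : Subgroup (BraidGroup (m + n - 1)) := Subgroup.closure (BmnSet m n)

/-! ### Relations among the standard generators -/

theorem sgen_of {n k : ℕ} (h : k < n) : sgen n (k + 1) = PresentedGroup.of ⟨k, h⟩ := by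
  simp [sgen, Nat.succ_le_of_lt h]

theorem sgen_commute (n : ℕ) {k l : ℕ} (h : k + 2 ≤ l) : Commute (sgen n k) (sgen n l) := by
  by_cases hk : 1 ≤ k ∧ k ≤ n
  · by_cases hl : 1 ≤ l ∧ l ≤ n
    · obtain ⟨k, rfl⟩ := Nat.exists_eq_add_of_le' hk.1
      obtain ⟨l, rfl⟩ := Nat.exists_eq_add_of_le' hl.1
      rw [sgen_of (Nat.lt_of_succ_le hk.2), sgen_of (Nat.lt_of_succ_le hl.2)]
      have : PresentedGroup.mk (braidRels n)
          (of ⟨k, hk.2⟩ * of ⟨l, hl.2⟩ * (of ⟨k, hk.2⟩)⁻¹ * (of ⟨l, hl.2⟩)⁻¹) = 1 :=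
        PresentedGroup.one_of_mem (Or.inl ⟨⟨k, hk.2⟩, ⟨l, hl.2⟩, Or.inl (by simp; omega), rfl⟩)
      simp only [_root_.map_mul, _root_.map_inv] at this
      rwa [mul_inv_eq_one, mul_inv_eq_iff_eq_mul] at this
    · simp [sgen, hl]
  · simp [sgen, hk]

theorem sgen_braid (n : ℕ) {k : ℕ} (h1 : 1 ≤ k) (h2 : k + 1 ≤ n) :
    sgen n k * sgen n (k + 1) * sgen n k = sgen n (k + 1) * sgen n k * sgen n (k + 1) := by
  obtain ⟨k, rfl⟩ := Nat.exists_eq_add_of_le' h1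
  rw [sgen_of (by omega : k < n), sgen_of (by omega : k + 1 < n)]
  have : PresentedGroup.mk (braidRels n)
      (of ⟨k, by omega⟩ * of ⟨k + 1, by omega⟩ * of ⟨k, by omega⟩ * (of ⟨k + 1, by omega⟩)⁻¹ *
        (of ⟨k, by omega⟩)⁻¹ * (of ⟨k + 1, by omega⟩)⁻¹) = 1 :=
    PresentedGroup.one_of_mem (Or.inr ⟨⟨k, by omega⟩, ⟨k + 1, by omega⟩, rfl, rfl⟩)
  simp only [_root_.map_mul, _root_.map_inv] at this
  rwa [mul_inv_eq_one, mul_inv_eq_iff_eq_mul, mul_inv_eq_iff_eq_mul] at this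

theorem mem_of_sgen_mem {n : ℕ} (K : Subgroup (BraidGroup n))
    (h : ∀ k, 1 ≤ k → k ≤ n → sgen n k ∈ K) (x : BraidGroup n) : x ∈ K :=
  PresentedGroup.generated_by _ K
    (fun j => sgen_of j.2 ▸ h (j + 1) (by omega) (by omega)) x

/-! ### Descending products and the generators `a_{ij}` -/

@[simp] theorem dprod_self_succ (n i : ℕ) : dprod n i (i + 1) = 1 := by simp [dprod]

theorem dprod_succ (n : ℕ) {i j : ℕ} (h : i < j) :
    dprod n i (j + 1) = sgen n j * dprod n i j := by
  unfold dprod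
  rw [show j + 1 - 1 - i = (j - 1 - i) + 1 by omega, List.range_succ_eq_map, List.map_cons,
    List.prod_cons, List.map_map]
  congr 3
  funext t
  simp only [Function.comp]
  congr 1
  omega

theorem dprod_mul_dprod (n : ℕ) {i k j : ℕ} (hik : i ≤ k) (hkj : k < j) :
    dprod n k j * dprod n i (k + 1) = dprod n i j := by
  induction j, hkj using Nat.le_induction with
  | base => simp
  | succ j hj ih => rw [dprod_succ n hj, mul_assoc, ih, dprod_succ n (by omega)]

theorem dprod_eq_mul_sgen (n : ℕ) {i j : ℕ} (h : i + 1 < j) :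
    dprod n i j = dprod n (i + 1) j * sgen n (i + 1) := by
  rw [← dprod_mul_dprod n (Nat.le_succ i) h, dprod_succ n (Nat.lt_succ_self i)]
  simp

theorem dprod_mem {n i j : ℕ} (hij : i < j) (K : Subgroup (BraidGroup n))
    (h : ∀ k, i < k → k < j → sgen n k ∈ K) : dprod n i j ∈ K := by
  induction j, hij using Nat.le_induction with
  | base => simp [K.one_mem]
  | succ j hj ih =>
    rw [dprod_succ n hj]
    exact K.mul_mem (h j hj (by omega)) (ih fun k h1 h2 => h k h1 (by omega))

theorem sgen_commute_dprod_of_lt (n : ℕ) {k i j : ℕ} (hk : k < i) (hij : i < j) :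
    Commute (sgen n k) (dprod n i j) := by
  induction j, hij using Nat.le_induction with
  | base => simp
  | succ j hj ih =>
    rw [dprod_succ n hj]
    exact (sgen_commute n (by omega)).mul_right ih

theorem sgen_commute_dprod_of_gt (n : ℕ) {k i j : ℕ} (hij : i < j) (hk : j < k) :
    Commute (sgen n k) (dprod n i j) := by
  induction j, hij using Nat.le_induction with
  | base => simp
  | succ j hj ih =>
    rw [dprod_succ n hj]
    exact (sgen_commute n (by omega)).symm.mul_right (ih (by omega))

theorem sgen_mul_dprod (n : ℕ) {k i j : ℕ} (hik : i < k) (hkj : k + 1 < j) (hk : k + 1 ≤ n) :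
    sgen n k * dprod n i j = dprod n i j * sgen n (k + 1) := by
  rw [← dprod_mul_dprod n (by omega : i ≤ k + 1) hkj, dprod_succ n (by omega : i < k + 1),
    dprod_succ n hik]
  have h1 := sgen_commute_dprod_of_lt n (Nat.lt_succ_self k) hkj
  have h2 := sgen_commute_dprod_of_gt n hik (Nat.lt_succ_self k)
  have h3 := sgen_braid n (by omega) hk
  calc _ = sgen n k * dprod n (k + 1) j * (sgen n (k + 1) * sgen n k) * dprod n i k := by group
    _ = dprod n (k + 1) j * (sgen n k * sgen n (k + 1) * sgen n k) * dprod n i k := by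
      rw [h1.eq]; group
    _ = dprod n (k + 1) j * (sgen n (k + 1) * sgen n k) * (sgen n (k + 1) * dprod n i k) := by
      rw [h3]; group
    _ = _ := by rw [h2.eq]; group

theorem agen_eq_conj (n : ℕ) {i k j : ℕ} (hik : i ≤ k) (hkj : k < j) :
    agen n i j = dprod n k j * agen n i (k + 1) * (dprod n k j)⁻¹ := by
  rw [agen, agen, ← dprod_mul_dprod n hik hkj]
  group

theorem agen_succ (n : ℕ) {i j : ℕ} (hij : i < j) :
    agen n i (j + 1) = sgen n j * agen n i j * (sgen n j)⁻¹ := by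
  rw [agen, agen, dprod_succ n hij]
  group

theorem sgen_commute_agen_of_lt (n : ℕ) {k i j : ℕ} (hk : k + 2 ≤ i) (hij : i < j) :
    Commute (sgen n k) (agen n i j) := by
  have h := sgen_commute_dprod_of_lt n (by omega : k < i) hij
  exact (h.mul_right ((sgen_commute n hk).pow_right 2)).mul_right h.inv_right

theorem sgen_commute_agen_of_gt (n : ℕ) {k i j : ℕ} (hij : i < j) (hk : j < k) :
    Commute (sgen n k) (agen n i j) := by
  have h := sgen_commute_dprod_of_gt n hij hk
  exact (h.mul_right ((sgen_commute n (by omega)).symm.pow_right 2)).mul_right h.inv_right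

theorem sgen_commute_agen_of_between (n : ℕ) {k i j : ℕ} (hik : i < k) (hkj : k + 1 < j)
    (hk : k + 1 ≤ n) : Commute (sgen n k) (agen n i j) := by
  have h := sgen_mul_dprod n hik hkj hk
  have h2 : Commute (sgen n (k + 1)) (sgen n i ^ 2) :=
    (sgen_commute n (by omega)).symm.pow_right 2
  change _ * _ = _ * _
  calc _ = sgen n k * dprod n i j * sgen n i ^ 2 * (dprod n i j)⁻¹ := by rw [agen]; group
    _ = dprod n i j * (sgen n i ^ 2 * sgen n (k + 1)) * (dprod n i j)⁻¹ := by
      rw [h, ← h2.eq]; group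
    _ = agen n i j * (sgen n k * dprod n i j) * (dprod n i j)⁻¹ := by rw [h, agen]; group
    _ = _ := by group

theorem mul_mul_sq_of_braid {G : Type*} [Group G] {x y : G} (h : x * y * x = y * x * y) :
    x * y * x ^ 2 = y ^ 2 * x * y := by
  calc _ = x * y * x * x := by simp only [pow_two, mul_assoc]
    _ = y * x * y * x := by rw [h]
    _ = y * (x * y * x) := by simp only [mul_assoc]
    _ = _ := by rw [h]; simp only [pow_two, mul_assoc]

theorem sgen_mul_agen_self (n : ℕ) {k j : ℕ} (h1 : 1 ≤ k) (hkj : k + 1 < j) (hk : k + 1 ≤ n) :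
    sgen n k * agen n k j = agen n (k + 1) j * sgen n k := by
  have hc := sgen_commute_dprod_of_lt n (Nat.lt_succ_self k) hkj
  have hb := sgen_braid n h1 hk
  have hb2 := mul_mul_sq_of_braid hb
  rw [agen, agen, dprod_eq_mul_sgen n hkj]
  calc _ = sgen n k * dprod n (k + 1) j * sgen n (k + 1) * sgen n k ^ 2 *
        (sgen n (k + 1))⁻¹ * (dprod n (k + 1) j)⁻¹ := by group
    _ = dprod n (k + 1) j * (sgen n k * sgen n (k + 1) * sgen n k ^ 2) *
        (sgen n (k + 1))⁻¹ * (dprod n (k + 1) j)⁻¹ := by rw [hc.eq]; group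
    _ = dprod n (k + 1) j * sgen n (k + 1) ^ 2 * (sgen n k * (dprod n (k + 1) j)⁻¹) := by
      rw [hb2]; group
    _ = _ := by rw [hc.inv_right.eq]; group

theorem sgen_mul_agen_succ (n : ℕ) {k j : ℕ} (hkj : k + 1 < j) (h1 : 1 ≤ k) (hk : k + 1 ≤ n) :
    sgen n k * agen n (k + 1) j =
      (agen n (k + 1) j)⁻¹ * agen n k j * agen n (k + 1) j * sgen n k := by
  have hc := sgen_commute_dprod_of_lt n (Nat.lt_succ_self k) hkj
  have hb := sgen_braid n h1 hk
  have hb2 := mul_mul_sq_of_braid hb.symm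
  rw [agen, agen, dprod_eq_mul_sgen n hkj]
  set D := dprod n (k + 1) j
  set x := sgen n k
  set y := sgen n (k + 1)
  calc _ = x * D * y ^ 2 * D⁻¹ := by group
    _ = D * y⁻¹ * (y * x * y ^ 2) * D⁻¹ := by rw [hc.eq]; group
    _ = D * y⁻¹ * x ^ 2 * y * (x * D⁻¹) := by rw [hb2]; group
    _ = _ := by rw [hc.inv_right.eq]; group

/-! ### The subgroup generated by the `a_{ij}` with `j` fixed -/

theorem sgen_mem_normalizer {n k j : ℕ} (h1 : 1 ≤ k) (hkj : k + 1 < j) (hk : k + 1 ≤ n)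
    (F : Subgroup (BraidGroup n))
    (hF : F = Subgroup.closure {x | ∃ i, 1 ≤ i ∧ i < j ∧ x = agen n i j}) :
    sgen n k ∈ Subgroup.normalizer (F : Set (BraidGroup n)) := by
  have hmem : ∀ i, 1 ≤ i → i < j → agen n i j ∈ F := fun i hi hij => by
    rw [hF]; exact Subgroup.subset_closure ⟨i, hi, hij, rfl⟩
  have hle : ∀ g : BraidGroup n, (∀ i, 1 ≤ i → i < j → g * agen n i j * g⁻¹ ∈ F) →
      ∀ x ∈ F, g * x * g⁻¹ ∈ F := by
    intro g hg
    have : F ≤ F.comap (MulAut.conj g).toMonoidHom := by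
      conv_lhs => rw [hF]
      rw [Subgroup.closure_le]
      rintro _ ⟨i, hi, hij, rfl⟩
      exact hg i hi hij
    exact fun x hx => this hx
  have hA := hmem k h1 (by omega)
  have hB := hmem (k + 1) (by omega) hkj
  have e1 := sgen_mul_agen_self n h1 hkj hk
  have e2 := sgen_mul_agen_succ n hkj h1 hk
  have hcomm : ∀ i, i ≠ k → i ≠ k + 1 → i < j → Commute (sgen n k) (agen n i j) := by
    intro i h h' hij
    rcases lt_or_gt_of_ne h with hlt | hgt
    · exact sgen_commute_agen_of_between n hlt hkj hk
    · exact sgen_commute_agen_of_lt n (by omega) hij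
  have fwd : ∀ x ∈ F, sgen n k * x * (sgen n k)⁻¹ ∈ F := by
    refine hle _ fun i hi hij => ?_
    by_cases h : i = k
    · subst h
      rwa [e1, mul_inv_cancel_right]
    by_cases h' : i = k + 1
    · subst h'
      rw [e2, mul_inv_cancel_right]
      exact F.mul_mem (F.mul_mem (F.inv_mem hB) hA) hB
    · rw [(hcomm i h h' hij).eq, mul_inv_cancel_right]
      exact hmem i hi hij
  have bwd : ∀ x ∈ F, (sgen n k)⁻¹ * x * (sgen n k)⁻¹⁻¹ ∈ F := by
    refine hle _ fun i hi hij => ?_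
    rw [inv_inv]
    by_cases h : i = k
    · subst h
      have : (sgen n i)⁻¹ * agen n i j * sgen n i =
          agen n i j * agen n (i + 1) j * (agen n i j)⁻¹ := by
        have e3 : agen n i j * sgen n i = sgen n i * agen n i j * agen n (i + 1) j *
            (agen n i j)⁻¹ := by
          rw [e1, mul_assoc _ (sgen n i), e2, eq_mul_inv_iff_mul_eq, mul_assoc, e1]
          group
        rw [mul_assoc, e3]; group
      rw [this]
      exact F.mul_mem (F.mul_mem hA hB) (F.inv_mem hA)
    by_cases h' : i = k + 1
    · subst h'
      rwa [mul_assoc, ← e1, inv_mul_cancel_left]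
    · rw [mul_assoc, ← (hcomm i h h' hij).eq, inv_mul_cancel_left]
      exact hmem i hi hij
  rw [Subgroup.mem_normalizer_iff]
  refine fun x => ⟨fwd x, fun h => ?_⟩
  have := bwd _ h
  simpa [mul_assoc] using this


/-! ### Cosets of the subgroup fixing the last strand -/

/-- The elements `x` which, for some permutation `τ` of `{m, …, s}`, carry the coset of `G₀`
represented by `(dprod s p (s + 1))⁻¹` to the one represented by
`(dprod s (τ p) (s + 1))⁻¹`, for all `p` in `{m, …, s}`. -/
def cosetPermuting (s m : ℕ) (G₀ : Subgroup (BraidGroup s)) : Subgroup (BraidGroup s) where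
  carrier := {x | ∃ τ : Equiv.Perm ℕ, (∀ p, τ p ∈ Set.Icc m s ↔ p ∈ Set.Icc m s) ∧
    ∀ p ∈ Set.Icc m s, dprod s (τ p) (s + 1) * x * (dprod s p (s + 1))⁻¹ ∈ G₀}
  mul_mem' := by
    rintro x y ⟨τ, hτ, hx⟩ ⟨υ, hυ, hy⟩
    refine ⟨τ * υ, fun p => (hτ _).trans (hυ p), fun p hp => ?_⟩
    have := G₀.mul_mem (hx (υ p) ((hυ p).2 hp)) (hy p hp)
    simpa [mul_assoc] using this
  one_mem' := ⟨1, fun p => Iff.rfl, fun p _ => by simp [G₀.one_mem]⟩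
  inv_mem' := by
    rintro x ⟨τ, hτ, hx⟩
    refine ⟨τ⁻¹, fun p => by rw [← hτ]; simp, fun p hp => ?_⟩
    have := G₀.inv_mem (hx (τ⁻¹ p) (by rw [← hτ]; simpa using hp))
    simpa [mul_assoc] using this

theorem sgen_mem_cosetPermuting {s m k : ℕ} (G₀ : Subgroup (BraidGroup s))
    (ha : ∀ i, 1 ≤ i → i ≤ s → agen s i (s + 1) ∈ G₀)
    (hσ : ∀ k, m + 1 ≤ k → k + 1 ≤ s → sgen s k ∈ G₀) (h1 : m + 1 ≤ k) (h2 : k ≤ s) :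
    sgen s k ∈ cosetPermuting s m G₀ := by
  obtain ⟨k, rfl⟩ := Nat.exists_eq_add_of_le' (by omega : 1 ≤ k)
  refine ⟨Equiv.swap k (k + 1), fun p => ?_, fun p hp => ?_⟩
  · simp only [Set.mem_Icc, Equiv.swap_apply_def]
    split_ifs <;> omega
  simp only [Set.mem_Icc] at hp
  by_cases hpk : p = k
  · subst hpk
    rw [Equiv.swap_apply_left, dprod_eq_mul_sgen s (by omega : p + 1 < s + 1), mul_inv_cancel]
    exact G₀.one_mem
  by_cases hpk' : p = k + 1
  · subst hpk'
    rw [Equiv.swap_apply_right, dprod_eq_mul_sgen s (by omega : k + 1 < s + 1)]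
    have := ha (k + 1) (by omega) h2
    rwa [agen, pow_two, ← mul_assoc] at this
  rw [Equiv.swap_apply_of_ne_of_ne hpk hpk']
  rcases lt_or_gt_of_ne hpk with h | h
  · rw [← sgen_mul_dprod s h (by omega) h2, mul_inv_cancel_right]
    exact hσ k (by omega) h2
  · rw [← (sgen_commute_dprod_of_lt s (by omega : k + 1 < p) (by omega : p < s + 1)).eq,
      mul_inv_cancel_right]
    exact hσ _ h1 (by omega)

theorem agen_mem_cosetPermuting {s m i j : ℕ} (G₀ : Subgroup (BraidGroup s))
    (ha : ∀ i, 1 ≤ i → i ≤ s → agen s i (s + 1) ∈ G₀)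
    (hσ : ∀ k, m + 1 ≤ k → k + 1 ≤ s → sgen s k ∈ G₀)
    (ha' : ∀ i, 1 ≤ i → i ≤ m → m < s → agen s i (m + 1) ∈ G₀)
    (hi : 1 ≤ i) (hij : i < j) (hmj : m + 1 ≤ j) (hj : j ≤ s + 1) :
    agen s i j ∈ cosetPermuting s m G₀ := by
  have hσ' := fun k => sgen_mem_cosetPermuting (k := k) G₀ ha hσ
  rcases lt_or_ge m i with hmi | him
  · have hD := dprod_mem (n := s) hij (cosetPermuting s m G₀)
      fun k _ _ => hσ' k (by omega) (by omega)
    exact mul_mem (mul_mem hD (pow_mem (hσ' i (by omega) (by omega)) 2)) (inv_mem hD)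
  induction j, hmj using Nat.le_induction with
  | base =>
    refine ⟨1, fun p => Iff.rfl, fun p hp => ?_⟩
    simp only [Set.mem_Icc] at hp
    rw [Equiv.Perm.one_apply]
    rcases hp.1.eq_or_lt with rfl | hmp
    · rw [← agen_eq_conj s him (by omega)]
      exact ha i hi (by omega)
    · have hc : Commute (dprod s p (s + 1)) (agen s i (m + 1)) := by
        have : dprod s p (s + 1) ∈ Subgroup.centralizer {agen s i (m + 1)} := by
          refine dprod_mem (by omega) _ fun k hk _ => ?_
          rw [Subgroup.mem_centralizer_singleton_iff]
          exact (sgen_commute_agen_of_gt s hij (by omega)).eq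
        exact Subgroup.mem_centralizer_singleton_iff.1 this
      rw [hc.eq, mul_inv_cancel_right]
      exact ha' i hi him (by omega)
  | succ j hj' ih =>
    rw [agen_succ s (by omega)]
    have := hσ' j (by omega) (by omega)
    exact mul_mem (mul_mem this (ih (by omega) (by omega))) (inv_mem this)

/-! ### Forgetting a strand -/

/-- The contribution of the crossing `σ_k` of `B_{s+1}` after the strand at position `p` has been
deleted. -/
def forgetCocycle (s t k p : ℕ) : BraidGroup t :=
  if p = 0 ∨ s + 1 < p then 1
  else if p < k then sgen t (k - 1) else if k + 1 < p then sgen t k else 1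

/-- The action of the crossing `σ_k` on pairs of a marked position and a braid on the unmarked
strands. -/
def forgetPerm (s t k : ℕ) : Equiv.Perm (ℕ × BraidGroup t) where
  toFun x := (Equiv.swap k (k + 1) x.1, forgetCocycle s t k x.1 * x.2)
  invFun x := (Equiv.swap k (k + 1) x.1,
    (forgetCocycle s t k (Equiv.swap k (k + 1) x.1))⁻¹ * x.2)
  left_inv x := by simp
  right_inv x := by simp

theorem forgetPerm_apply (s t k p : ℕ) (g : BraidGroup t) :
    forgetPerm s t k (p, g) = (Equiv.swap k (k + 1) p, forgetCocycle s t k p * g) := rfl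

theorem forgetPerm_self (s t k : ℕ) (g : BraidGroup t) :
    forgetPerm s t k (k, g) = (k + 1, g) := by
  simp [forgetPerm_apply, forgetCocycle]

theorem forgetPerm_succ (s t k : ℕ) (g : BraidGroup t) :
    forgetPerm s t k (k + 1, g) = (k, g) := by
  simp [forgetPerm_apply, forgetCocycle]

theorem forgetPerm_of_lt {s t k p : ℕ} (hp : 1 ≤ p) (hpk : p < k) (hk : k ≤ s)
    (g : BraidGroup t) : forgetPerm s t k (p, g) = (p, sgen t (k - 1) * g) := by
  rw [forgetPerm_apply, Equiv.swap_apply_of_ne_of_ne (by omega) (by omega), forgetCocycle,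
    if_neg (by omega), if_pos hpk]

theorem forgetPerm_of_gt {s t k p : ℕ} (hpk : k + 1 < p) (hp : p ≤ s + 1)
    (g : BraidGroup t) : forgetPerm s t k (p, g) = (p, sgen t k * g) := by
  rw [forgetPerm_apply, Equiv.swap_apply_of_ne_of_ne (by omega) (by omega), forgetCocycle,
    if_neg (by omega), if_neg (by omega), if_pos hpk]

theorem forgetPerm_of_outside {s t k p : ℕ} (hk : 1 ≤ k) (hks : k ≤ s) (hp : p = 0 ∨ s + 1 < p)
    (g : BraidGroup t) : forgetPerm s t k (p, g) = (p, g) := by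
  rw [forgetPerm_apply, Equiv.swap_apply_of_ne_of_ne (by omega) (by omega), forgetCocycle,
    if_pos hp, one_mul]

theorem forgetPerm_commute {s t k l : ℕ} (hk : 1 ≤ k) (h : k + 2 ≤ l) (hl : l ≤ s) :
    Commute (forgetPerm s t k) (forgetPerm s t l) := by
  have hc : ∀ a b, a + 2 ≤ b → ∀ g : BraidGroup t,
      sgen t a * (sgen t b * g) = sgen t b * (sgen t a * g) := fun a b hab g => by
    rw [← mul_assoc, (sgen_commute t hab).eq, mul_assoc]
  refine Equiv.ext ?_
  rintro ⟨p, g⟩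
  rw [Equiv.Perm.mul_apply, Equiv.Perm.mul_apply]
  by_cases hp : p = 0 ∨ s + 1 < p
  · simp (discharger := omega) only [forgetPerm_of_outside]
  rcases (by omega : p < k ∨ p = k ∨ p = k + 1 ∨ (k + 1 < p ∧ p < l) ∨ p = l ∨ p = l + 1 ∨
    l + 1 < p) with h1 | rfl | rfl | ⟨h1, h2⟩ | rfl | rfl | h1
  · simp (discharger := omega) only [forgetPerm_of_lt]
    rw [hc _ _ (by omega)]
  · simp (discharger := omega) only [forgetPerm_of_lt, forgetPerm_self]
  · simp (discharger := omega) only [forgetPerm_of_lt, forgetPerm_succ]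
  · simp (discharger := omega) only [forgetPerm_of_lt, forgetPerm_of_gt]
    rw [hc _ _ (by omega)]
  · simp (discharger := omega) only [forgetPerm_of_gt, forgetPerm_self]
  · simp (discharger := omega) only [forgetPerm_of_gt, forgetPerm_succ]
  · simp (discharger := omega) only [forgetPerm_of_gt]
    rw [hc _ _ (by omega)]

theorem forgetPerm_braid {s t k : ℕ} (hs : s = t + 1) (hk : 1 ≤ k) (hks : k + 1 ≤ s) :
    forgetPerm s t k * forgetPerm s t (k + 1) * forgetPerm s t k =
      forgetPerm s t (k + 1) * forgetPerm s t k * forgetPerm s t (k + 1) := by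
  have hb : ∀ a, 1 ≤ a → a + 1 ≤ t → ∀ g : BraidGroup t,
      sgen t a * (sgen t (a + 1) * (sgen t a * g)) =
        sgen t (a + 1) * (sgen t a * (sgen t (a + 1) * g)) := fun a h1 h2 g => by
    simp only [← mul_assoc, sgen_braid t h1 h2]
  refine Equiv.ext ?_
  rintro ⟨p, g⟩
  simp only [Equiv.Perm.mul_apply]
  by_cases hp : p = 0 ∨ s + 1 < p
  · simp (discharger := omega) only [forgetPerm_of_outside]
  rcases (by omega : p < k ∨ p = k ∨ p = k + 1 ∨ p = k + 1 + 1 ∨ k + 1 + 1 < p) with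
    h1 | rfl | rfl | rfl | h1
  · obtain ⟨k, rfl⟩ := Nat.exists_eq_add_of_le' hk
    simp (discharger := omega) only [forgetPerm_of_lt, Nat.add_sub_cancel]
    rw [hb _ (by omega) (by omega)]
  · simp (discharger := omega) only [forgetPerm_of_lt, forgetPerm_of_gt, forgetPerm_self,
      Nat.add_sub_cancel]
  · simp (discharger := omega) only [forgetPerm_of_lt, forgetPerm_of_gt, forgetPerm_self,
      forgetPerm_succ, Nat.add_sub_cancel]
  · simp (discharger := omega) only [forgetPerm_of_lt, forgetPerm_of_gt, forgetPerm_succ,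
      Nat.add_sub_cancel]
  · simp (discharger := omega) only [forgetPerm_of_gt]
    rw [hb _ (by omega) (by omega)]

/-- The action of `B_{s+1}` on pairs of a marked position and a braid on the remaining strands. -/
def forgetHom (s t : ℕ) (hs : s = t + 1) : BraidGroup s →* Equiv.Perm (ℕ × BraidGroup t) :=
  PresentedGroup.toGroup (f := fun k : Fin s => forgetPerm s t (k + 1)) <| by
    rintro _ (⟨k, l, h, rfl⟩ | ⟨k, l, h, rfl⟩)
    · simp only [_root_.map_mul, _root_.map_inv, lift_apply_of]
      rw [mul_inv_eq_one, mul_inv_eq_iff_eq_mul]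
      rcases h with h | h
      · exact forgetPerm_commute (by omega) (by omega) (by omega)
      · exact (forgetPerm_commute (by omega) (by omega) (by omega)).symm
    · simp only [_root_.map_mul, _root_.map_inv, lift_apply_of, h]
      rw [mul_inv_eq_one, mul_inv_eq_iff_eq_mul, mul_inv_eq_iff_eq_mul]
      exact forgetPerm_braid hs (by omega) (by omega)

theorem forgetHom_sgen {s t k : ℕ} (hs : s = t + 1) (h1 : 1 ≤ k) (h2 : k ≤ s) :
    forgetHom s t hs (sgen s k) = forgetPerm s t k := by
  obtain ⟨k, rfl⟩ := Nat.exists_eq_add_of_le' h1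
  rw [sgen_of (by omega : k < s)]
  exact PresentedGroup.toGroup.of _

theorem forgetHom_sgen_self {s t k : ℕ} (hs : s = t + 1) (h1 : 1 ≤ k) (h2 : k ≤ s)
    (g : BraidGroup t) : forgetHom s t hs (sgen s k) (k, g) = (k + 1, g) := by
  rw [forgetHom_sgen hs h1 h2, forgetPerm_self]

theorem forgetHom_sgen_succ {s t k : ℕ} (hs : s = t + 1) (h1 : 1 ≤ k) (h2 : k ≤ s)
    (g : BraidGroup t) : forgetHom s t hs (sgen s k) (k + 1, g) = (k, g) := by
  rw [forgetHom_sgen hs h1 h2, forgetPerm_succ]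

theorem forgetHom_dprod {s t i j : ℕ} (hs : s = t + 1) (hij : i < j) (hj : j ≤ s + 1)
    (g : BraidGroup t) : forgetHom s t hs (dprod s i j) (i + 1, g) = (j, g) := by
  induction j, hij using Nat.le_induction with
  | base => simp
  | succ j hij' ih =>
    rw [dprod_succ s hij', _root_.map_mul, Equiv.Perm.mul_apply, ih (by omega),
      forgetHom_sgen_self hs (by omega) (by omega)]

theorem forgetHom_agen {s t i j : ℕ} (hs : s = t + 1) (hi : 1 ≤ i) (hij : i < j) (hj : j ≤ s + 1)
    (g : BraidGroup t) : forgetHom s t hs (agen s i j) (j, g) = (j, g) := by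
  have h := forgetHom_dprod hs hij hj g
  rw [agen, _root_.map_mul, _root_.map_mul, _root_.map_inv, Equiv.Perm.mul_apply, Equiv.Perm.mul_apply,
    Equiv.Perm.inv_eq_iff_eq.2 h.symm, _root_.map_pow, pow_two, Equiv.Perm.mul_apply,
    forgetHom_sgen_succ hs hi (by omega), forgetHom_sgen_self hs hi (by omega), h]

theorem forgetHom_map {s t : ℕ} (hs : s = t + 1) (ι : BraidGroup t →* BraidGroup s)
    (hι : ∀ k, 1 ≤ k → k ≤ t → ι (sgen t k) = sgen s k) (x g : BraidGroup t) :
    forgetHom s t hs (ι x) (s + 1, g) = (s + 1, x * g) := by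
  let K : Subgroup (BraidGroup t) :=
    { carrier := {x | ∀ g, forgetHom s t hs (ι x) (s + 1, g) = (s + 1, x * g)}
      mul_mem' := fun {x y} hx hy g => by
        rw [_root_.map_mul, _root_.map_mul, Equiv.Perm.mul_apply, hy, hx, mul_assoc]
      one_mem' := fun g => by simp
      inv_mem' := fun {x} hx g => by
        rw [_root_.map_inv, _root_.map_inv, Equiv.Perm.inv_eq_iff_eq, hx, mul_inv_cancel_left] }
  refine mem_of_sgen_mem K (fun k h1 h2 g => ?_) x g
  rw [hι k h1 h2, forgetHom_sgen hs h1 (by omega), forgetPerm_of_gt (by omega) le_rfl]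

theorem eq_one_of_map_mem {s t : ℕ} (hs : s = t + 1) (ι : BraidGroup t →* BraidGroup s)
    (hι : ∀ k, 1 ≤ k → k ≤ t → ι (sgen t k) = sgen s k) {x : BraidGroup t}
    (hx : ι x ∈ Subgroup.closure {x | ∃ i, 1 ≤ i ∧ i < s + 1 ∧ x = agen s i (s + 1)}) :
    x = 1 := by
  have hle : Subgroup.closure {x | ∃ i, 1 ≤ i ∧ i < s + 1 ∧ x = agen s i (s + 1)} ≤
      (MulAction.stabilizer (Equiv.Perm (ℕ × BraidGroup t)) (s + 1, (1 : BraidGroup t))).comap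
        (forgetHom s t hs) := by
    rw [Subgroup.closure_le]
    rintro _ ⟨i, hi, his, rfl⟩
    exact forgetHom_agen hs hi his le_rfl 1
  have h : forgetHom s t hs (ι x) (s + 1, 1) = (s + 1, 1) := hle hx
  rw [forgetHom_map hs ι hι] at h
  simpa using h


/-! ### The inclusion of braid groups -/

theorem map_dprod {s t i j : ℕ} (ι : BraidGroup t →* BraidGroup s)
    (hι : ∀ k, 1 ≤ k → k ≤ t → ι (sgen t k) = sgen s k) (hij : i < j) (hj : j ≤ t + 1) :
    ι (dprod t i j) = dprod s i j := by
  induction j, hij using Nat.le_induction with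
  | base => simp
  | succ j hij' ih =>
    rw [dprod_succ t hij', dprod_succ s hij', _root_.map_mul, ih (by omega),
      hι j (by omega) (by omega)]

theorem map_agen {s t i j : ℕ} (ι : BraidGroup t →* BraidGroup s)
    (hι : ∀ k, 1 ≤ k → k ≤ t → ι (sgen t k) = sgen s k) (hi : 1 ≤ i) (hij : i < j)
    (hj : j ≤ t + 1) : ι (agen t i j) = agen s i j := by
  rw [agen, agen, _root_.map_mul, _root_.map_mul, _root_.map_inv, _root_.map_pow,
    map_dprod ι hι hij hj, hι i hi (by omega)]

/-! ### Underlying permutations -/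

theorem perm_dprod {s N i j : ℕ} (hN : N = s + 1) (π : BraidGroup s →* Equiv.Perm (Fin N))
    (hπ : ∀ k, ∀ h1 : 1 ≤ k, ∀ h2 : k ≤ s, π (sgen s k) =
      Equiv.swap (⟨k - 1, by omega⟩ : Fin N) (⟨k, by omega⟩ : Fin N))
    (hij : i < j) (hj : j ≤ N) :
    π (dprod s i j) ⟨i, by omega⟩ = ⟨j - 1, by omega⟩ := by
  induction j, hij using Nat.le_induction with
  | base => simp
  | succ j hij' ih =>
    rw [dprod_succ s hij', _root_.map_mul, Equiv.Perm.mul_apply, ih (by omega),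
      hπ j (by omega) (by omega), Equiv.swap_apply_left]
    rfl

theorem perm_agen {s N i : ℕ} (j : ℕ) (hN : N = s + 1) (π : BraidGroup s →* Equiv.Perm (Fin N))
    (hπ : ∀ k, ∀ h1 : 1 ≤ k, ∀ h2 : k ≤ s, π (sgen s k) =
      Equiv.swap (⟨k - 1, by omega⟩ : Fin N) (⟨k, by omega⟩ : Fin N))
    (hi : 1 ≤ i) (his : i ≤ s) : π (agen s i j) = 1 := by
  rw [agen, _root_.map_mul, _root_.map_mul, _root_.map_inv, _root_.map_pow, hπ i hi his, pow_two,
    Equiv.swap_mul_self, mul_one, mul_inv_cancel]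

theorem perm_map_last {s t N : ℕ} (hs : s = t + 1) (hN : N = s + 1)
    (π : BraidGroup s →* Equiv.Perm (Fin N))
    (hπ : ∀ k, ∀ h1 : 1 ≤ k, ∀ h2 : k ≤ s, π (sgen s k) =
      Equiv.swap (⟨k - 1, by omega⟩ : Fin N) (⟨k, by omega⟩ : Fin N))
    (ι : BraidGroup t →* BraidGroup s)
    (hι : ∀ k, 1 ≤ k → k ≤ t → ι (sgen t k) = sgen s k) (x : BraidGroup t) :
    π (ι x) ⟨s, by omega⟩ = ⟨s, by omega⟩ := by
  refine mem_of_sgen_mem ((MulAction.stabilizer (Equiv.Perm (Fin N))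
    (⟨s, by omega⟩ : Fin N)).comap (π.comp ι)) (fun k h1 h2 => ?_) x
  change π (ι (sgen t k)) _ = _
  rw [hι k h1 h2, hπ k h1 (by omega), Equiv.swap_apply_of_ne_of_ne] <;>
    simp only [ne_eq, Fin.mk.injEq] <;> omega

theorem perm_map_castLE {s t N : ℕ} (hN : N = s + 1) {M : ℕ} (hM : M = t + 1) (hMN : M ≤ N)
    (π : BraidGroup s →* Equiv.Perm (Fin N))
    (hπ : ∀ k, ∀ h1 : 1 ≤ k, ∀ h2 : k ≤ s, π (sgen s k) =
      Equiv.swap (⟨k - 1, by omega⟩ : Fin N) (⟨k, by omega⟩ : Fin N))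
    (π' : BraidGroup t →* Equiv.Perm (Fin M))
    (hπ' : ∀ k, ∀ h1 : 1 ≤ k, ∀ h2 : k ≤ t, π' (sgen t k) =
      Equiv.swap (⟨k - 1, by omega⟩ : Fin M) (⟨k, by omega⟩ : Fin M))
    (ι : BraidGroup t →* BraidGroup s)
    (hι : ∀ k, 1 ≤ k → k ≤ t → ι (sgen t k) = sgen s k) (x : BraidGroup t) (p : Fin M) :
    π (ι x) (p.castLE hMN) = (π' x p).castLE hMN := by
  let K : Subgroup (BraidGroup t) :=
    { carrier := {x | ∀ p : Fin M, π (ι x) (p.castLE hMN) = (π' x p).castLE hMN}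
      mul_mem' := fun {x y} hx hy p => by
        rw [_root_.map_mul, _root_.map_mul, _root_.map_mul, Equiv.Perm.mul_apply, hy, hx,
          Equiv.Perm.mul_apply]
      one_mem' := fun p => by simp
      inv_mem' := fun {x} hx p => by
        rw [_root_.map_inv, _root_.map_inv, _root_.map_inv, Equiv.Perm.inv_eq_iff_eq, hx,
          ← Equiv.Perm.mul_apply, mul_inv_cancel, Equiv.Perm.one_apply] }
  refine mem_of_sgen_mem K (fun k h1 h2 p => ?_) x p
  rw [hι k h1 h2, hπ k h1 (by omega), hπ' k h1 h2]
  simp only [Equiv.swap_apply_def, Fin.ext_iff, Fin.val_castLE]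
  split_ifs <;> rfl

/-- The cosets of `F ⋅ ι(B_{m,n-1})` represented by the inverses of `dprod s q (s + 1)`,
`m ≤ q ≤ s`, cover `B_{m,n}`. -/
theorem exists_dprod_mul_mem {s m : ℕ} (hm : m ≤ s) (G₀ : Subgroup (BraidGroup s))
    (ha : ∀ i, 1 ≤ i → i ≤ s → agen s i (s + 1) ∈ G₀)
    (hσ : ∀ k, m + 1 ≤ k → k + 1 ≤ s → sgen s k ∈ G₀)
    (ha' : ∀ i, 1 ≤ i → i ≤ m → m < s → agen s i (m + 1) ∈ G₀)
    {A : BraidGroup s} {S : Set (BraidGroup s)} (hA : A ∈ Subgroup.closure S)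
    (hS : ∀ x ∈ S, (∃ i j, 1 ≤ i ∧ i < j ∧ m + 1 ≤ j ∧ j ≤ s + 1 ∧ x = agen s i j) ∨
      ∃ k, m + 1 ≤ k ∧ k ≤ s ∧ x = sgen s k) :
    ∃ q, m ≤ q ∧ q ≤ s ∧ dprod s q (s + 1) * A ∈ G₀ := by
  have hle : Subgroup.closure S ≤ cosetPermuting s m G₀ := by
    rw [Subgroup.closure_le]
    intro x hx
    rcases hS x hx with ⟨i, j, h1, h2, h3, h4, rfl⟩ | ⟨k, h1, h2, rfl⟩
    · exact agen_mem_cosetPermuting G₀ ha hσ ha' h1 h2 h3 h4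
    · exact sgen_mem_cosetPermuting G₀ ha hσ h1 h2
  obtain ⟨τ, hτ, h⟩ := hle hA
  have hs : s ∈ Set.Icc m s := ⟨hm, le_rfl⟩
  refine ⟨τ s, ((hτ s).2 hs).1, ((hτ s).2 hs).2, ?_⟩
  simpa using h s hs

/-- Combing decomposition `P_{m,n} = F_{m+n−1} ⋊ P_{m,n−1}`: every `A ∈ P_{m,n}` is in
exactly one way a product `A = u · h` with `u ∈ F` (the subgroup generated by
`a_{1,m+n}, …, a_{m+n−1,m+n}`) and `h ∈ H = ι(P_{m,n−1})`, where
`ι : B_{m+n−1} → B_{m+n}` is the homomorphism determined by `σ_k ↦ σ_k`. -/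
theorem statement13 (m n : ℕ) (hm : 1 ≤ m) (hn : 2 ≤ n)
    (π : BraidGroup (m + n - 1) →* Equiv.Perm (Fin (m + n)))
    (hπ : ∀ k : ℕ, ∀ _hk1 : 1 ≤ k, ∀ _hk2 : k ≤ m + n - 1,
      π (sgen (m + n - 1) k) =
        Equiv.swap (⟨k - 1, by omega⟩ : Fin (m + n)) (⟨k, by omega⟩ : Fin (m + n)))
    (π' : BraidGroup (m + (n - 1) - 1) →* Equiv.Perm (Fin (m + (n - 1))))
    (hπ' : ∀ k : ℕ, ∀ _hk1 : 1 ≤ k, ∀ _hk2 : k ≤ m + (n - 1) - 1,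
      π' (sgen (m + (n - 1) - 1) k) =
        Equiv.swap (⟨k - 1, by omega⟩ : Fin (m + (n - 1))) (⟨k, by omega⟩ : Fin (m + (n - 1))))
    (ι : BraidGroup (m + (n - 1) - 1) →* BraidGroup (m + n - 1))
    (hι : ∀ k : ℕ, 1 ≤ k → k ≤ m + (n - 1) - 1 →
      ι (sgen (m + (n - 1) - 1) k) = sgen (m + n - 1) k)
    (F : Subgroup (BraidGroup (m + n - 1)))
    (hF : F = Subgroup.closure
      {x | ∃ i : ℕ, 1 ≤ i ∧ i ≤ m + n - 1 ∧ x = agen (m + n - 1) i (m + n)})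
    (H : Subgroup (BraidGroup (m + n - 1)))
    (hH : H = (Bmn m (n - 1) ⊓ π'.ker).map ι) :
    ∀ A ∈ Bmn m n ⊓ π.ker,
      ∃! p : BraidGroup (m + n - 1) × BraidGroup (m + n - 1),
        p.1 ∈ F ∧ p.2 ∈ H ∧ A = p.1 * p.2 := by
  have hs : m + n - 1 = (m + (n - 1) - 1) + 1 := by omega
  have hN : m + n = (m + n - 1) + 1 := by omega
  have hM : m + (n - 1) = (m + (n - 1) - 1) + 1 := by omega
  have hF' : F = Subgroup.closure
      {x | ∃ i, 1 ≤ i ∧ i < m + n - 1 + 1 ∧ x = agen (m + n - 1) i (m + n - 1 + 1)} := by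
    rw [hF, ← hN]
    congr 1
    ext x
    exact exists_congr fun i => by rw [Nat.lt_iff_le_pred (by omega : 0 < m + n)]
  have hπF : F ≤ π.ker := by
    rw [hF, Subgroup.closure_le]
    rintro _ ⟨i, h1, h2, rfl⟩
    exact perm_agen _ hN π hπ h1 h2
  have hnorm : (Bmn m (n - 1)).map ι ≤
      Subgroup.normalizer (F : Set (BraidGroup (m + n - 1))) := by
    rintro _ ⟨x, -, rfl⟩
    refine mem_of_sgen_mem ((Subgroup.normalizer (F : Set (BraidGroup (m + n - 1)))).comap ι)
      (fun k h1 h2 => ?_) x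
    rw [Subgroup.mem_comap, hι k h1 h2]
    exact sgen_mem_normalizer h1 (by omega) (by omega) F hF'
  rintro A ⟨hA, hAπ⟩
  obtain ⟨q, hmq, hq, hqA⟩ := exists_dprod_mul_mem (m := m) (by omega)
    (F ⊔ (Bmn m (n - 1)).map ι)
    (fun i h1 h2 => le_sup_left (a := F) <| by
      rw [hF']; exact Subgroup.subset_closure ⟨i, h1, by omega, rfl⟩)
    (fun k h1 h2 => le_sup_right (a := F) <| by
      rw [← hι k (by omega) (by omega)]
      exact Subgroup.mem_map_of_mem ι (Subgroup.subset_closure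
        (Or.inr ⟨k, h1, by omega, rfl⟩)))
    (fun i h1 h2 h3 => le_sup_right (a := F) <| by
      rw [← map_agen (j := m + 1) ι hι h1 (by omega) (by omega)]
      exact Subgroup.mem_map_of_mem ι (Subgroup.subset_closure
        (Or.inl ⟨i, m + 1, h1, by omega, le_rfl, by omega, rfl⟩)))
    hA (by
      rintro x (⟨i, j, h1, h2, h3, h4, rfl⟩ | ⟨k, h1, h2, rfl⟩)
      · exact Or.inl ⟨i, j, h1, h2, h3, by omega, rfl⟩
      · exact Or.inr ⟨k, h1, h2, rfl⟩)
  rw [← SetLike.mem_coe, Subgroup.coe_mul_of_right_le_normalizer_left _ _ hnorm] at hqA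
  obtain ⟨u, hu, _, ⟨x, hx, rfl⟩, huh⟩ := hqA
  replace huh : u * ι x = dprod (m + n - 1) q (m + n - 1 + 1) * A := huh
  have hπuh : π (ι x) = π (dprod (m + n - 1) q (m + n - 1 + 1)) := by
    have := congrArg π huh
    rwa [_root_.map_mul, _root_.map_mul, MonoidHom.mem_ker.1 (hπF hu),
      MonoidHom.mem_ker.1 hAπ, one_mul, mul_one] at this
  obtain rfl : q = m + n - 1 := by
    have h1 := perm_dprod hN π hπ (by omega : q < m + n - 1 + 1) (by omega)
    rw [← hπuh] at h1
    have h2 := h1.trans (perm_map_last hs hN π hπ ι hι x).symm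
    simpa using (π (ι x)).injective h2
  rw [dprod_self_succ, _root_.map_one] at hπuh
  rw [dprod_self_succ, one_mul] at huh
  have hxπ : π' x = 1 := by
    ext p
    have := perm_map_castLE hN hM (by omega) π hπ π' hπ' ι hι x p
    rw [hπuh] at this
    simpa [Fin.ext_iff] using this.symm
  refine ⟨(u, ι x), ⟨hu, ?_, huh.symm⟩, ?_⟩
  · rw [hH]
    exact Subgroup.mem_map_of_mem ι ⟨hx, hxπ⟩
  rintro ⟨v, _⟩ ⟨hv, hy, hvy⟩
  rw [hH] at hy
  obtain ⟨y, -, rfl⟩ := hy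
  dsimp only at hv hvy
  have hxy : ι (x * y⁻¹) = u⁻¹ * v := by
    rw [_root_.map_mul, _root_.map_inv, mul_inv_eq_iff_eq_mul, mul_assoc, ← hvy, ← huh,
      inv_mul_cancel_left]
  have hmem : ι (x * y⁻¹) ∈ F := hxy ▸ F.mul_mem (F.inv_mem hu) hv
  rw [hF'] at hmem
  obtain rfl : x = y := mul_inv_eq_one.1 (eq_one_of_map_mem hs ι hι hmem)
  rw [mul_inv_cancel, _root_.map_one] at hxy
  rw [inv_mul_eq_one.1 hxy.symm]

end BraidPaper
end

section
/- (Theorem 2) Let G be the presented group on generators x_{ij} (1 ≤ i ≤ m, m+1 ≤ j ≤ m+n) and s_k (m+1 ≤ k ≤ m+n−1), subject to the relations (Σ1) s_k s_l = s_l s_k for |k−l| > 1, (Σ2) s_k s_{k+1} s_k = s_{k+1} s_k s_{k+1}, (1) s_k⁻¹ x_{ij} s_k = x_{ij} for k ≤ j−2 or k ≥ j+1, (2) x_{ij} = s_{j−1} x_{i,j−1} s_{j−1}⁻¹ for j ≥ m+2, (3) s_j⁻¹ x_{ij} s_j = x_{ij} x_{i,j+1} x_{ij}⁻¹ for j ≤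 m+n−1, and (4) x_{ij} x_{r,j+1} = x_{r,j+1} x_{ij} for r < i ≤ m and j ≤ m+n−1. Then there is a group isomorphism from G onto B_{m,n} sending each x_{ij} to a_{ij} and each s_k to σ_k. -/
open FreeGroup

namespace BraidPaper

/-- Index set for the presentation of Theorem 2: generators `x_{ij}`
(`1 ≤ i ≤ m`, `m+1 ≤ j ≤ m+n`) and `s_k` (`m+1 ≤ k ≤ m+n−1`). -/
def MixedIdx (m n : ℕ) : Type :=
  {p : ℕ × ℕ // 1 ≤ p.1 ∧ p.1 ≤ m ∧ m + 1 ≤ p.2 ∧ p.2 ≤ m + n} ⊕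
    {k : ℕ // m + 1 ≤ k ∧ k ≤ m + n - 1}

/-- The relators Σ1, Σ2, (1), (2), (3), (4) of Theorem 2, as words in the free group
on `MixedIdx m n`. -/
def mixedRels (m n : ℕ) : Set (FreeGroup (MixedIdx m n)) :=
  -- (Σ1)  s_k s_l = s_l s_k  for |k−l| > 1
  {x | ∃ k l : {k : ℕ // m + 1 ≤ k ∧ k ≤ m + n - 1}, (k.1 + 1 < l.1 ∨ l.1 + 1 < k.1) ∧
      x = of (Sum.inr k) * of (Sum.inr l) * (of (Sum.inr k))⁻¹ * (of (Sum.inr l))⁻¹} ∪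
  -- (Σ2)  s_k s_{k+1} s_k = s_{k+1} s_k s_{k+1}
  {x | ∃ k : ℕ, ∃ _h : m + 1 ≤ k ∧ k + 1 ≤ m + n - 1,
      x = of (Sum.inr ⟨k, by omega⟩) * of (Sum.inr ⟨k + 1, by omega⟩) *
            of (Sum.inr ⟨k, by omega⟩) *
          (of (Sum.inr ⟨k + 1, by omega⟩) * of (Sum.inr ⟨k, by omega⟩) *
            of (Sum.inr ⟨k + 1, by omega⟩))⁻¹} ∪
  -- (1)  s_k⁻¹ x_{ij} s_k = x_{ij}  for  k ≤ j−2  or  k ≥ j+1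
  {x | ∃ i j k : ℕ, ∃ _h : (1 ≤ i ∧ i ≤ m ∧ m + 1 ≤ j ∧ j ≤ m + n ∧
        m + 1 ≤ k ∧ k ≤ m + n - 1) ∧ (k + 2 ≤ j ∨ j + 1 ≤ k),
      x = (of (Sum.inr ⟨k, by omega⟩))⁻¹ * of (Sum.inl ⟨(i, j), by omega⟩) *
            of (Sum.inr ⟨k, by omega⟩) * (of (Sum.inl ⟨(i, j), by omega⟩))⁻¹} ∪
  -- (2)  x_{ij} = s_{j−1} x_{i,j−1} s_{j−1}⁻¹  for  j ≥ m+2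
  {x | ∃ i j : ℕ, ∃ _h : 1 ≤ i ∧ i ≤ m ∧ m + 2 ≤ j ∧ j ≤ m + n,
      x = of (Sum.inl ⟨(i, j), by omega⟩) *
          (of (Sum.inr ⟨j - 1, by omega⟩) * of (Sum.inl ⟨(i, j - 1), by omega⟩) *
            (of (Sum.inr ⟨j - 1, by omega⟩))⁻¹)⁻¹} ∪
  -- (3)  s_j⁻¹ x_{ij} s_j = x_{ij} x_{i,j+1} x_{ij}⁻¹  for  j ≤ m+n−1
  {x | ∃ i j : ℕ, ∃ _h : 1 ≤ i ∧ i ≤ m ∧ m + 1 ≤ j ∧ j ≤ m + n - 1,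
      x = (of (Sum.inr ⟨j, by omega⟩))⁻¹ * of (Sum.inl ⟨(i, j), by omega⟩) *
            of (Sum.inr ⟨j, by omega⟩) *
          (of (Sum.inl ⟨(i, j), by omega⟩) * of (Sum.inl ⟨(i, j + 1), by omega⟩) *
            (of (Sum.inl ⟨(i, j), by omega⟩))⁻¹)⁻¹} ∪
  -- (4)  x_{ij} x_{r,j+1} = x_{r,j+1} x_{ij}  for  r < i ≤ m  and  j ≤ m+n−1
  {x | ∃ i r j : ℕ, ∃ _h : 1 ≤ r ∧ r < i ∧ i ≤ m ∧ m + 1 ≤ j ∧ j ≤ m + n - 1,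
      x = of (Sum.inl ⟨(i, j), by omega⟩) * of (Sum.inl ⟨(r, j + 1), by omega⟩) *
          (of (Sum.inl ⟨(r, j + 1), by omega⟩) * of (Sum.inl ⟨(i, j), by omega⟩))⁻¹}

section Words

variable {G K : Type*} [Group G] [Group K]

/-- The descending product `s_{j-1} s_{j-2} ⋯ s_{i+1}` in an arbitrary group. -/
def desc (s : ℕ → G) (i j : ℕ) : G :=
  ((List.range (j - 1 - i)).map fun t => s (j - 1 - t)).prod

/-- The word `s_{j-1} ⋯ s_{i+1} s_i² s_{i+1}⁻¹ ⋯ s_{j-1}⁻¹` in an arbitrary group. -/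
def pureWord (s : ℕ → G) (i j : ℕ) : G := desc s i j * s i ^ 2 * (desc s i j)⁻¹

theorem desc_of_le (s : ℕ → G) {i j : ℕ} (h : j ≤ i + 1) : desc s i j = 1 := by
  have : j - 1 - i = 0 := by omega
  simp [desc, this]

theorem desc_succ_right (s : ℕ → G) {i j : ℕ} (h : i < j) :
    desc s i (j + 1) = s j * desc s i j := by
  have : j + 1 - 1 - i = (j - 1 - i) + 1 := by omega
  rw [desc, desc, this, List.range_succ_eq_map]
  simp only [List.map_cons, List.map_map, List.prod_cons]
  congr 3
  ext t
  simp only [Function.comp]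
  congr 1
  omega

theorem desc_succ_left (s : ℕ → G) {i j : ℕ} (h : i + 1 < j) :
    desc s i j = desc s (i + 1) j * s (i + 1) := by
  have : j - 1 - i = (j - 1 - (i + 1)) + 1 := by omega
  rw [desc, desc, this, List.range_succ]
  simp only [List.map_append, List.prod_append, List.map_cons, List.map_nil, List.prod_cons,
    List.prod_nil, mul_one]
  congr 2
  omega

theorem map_desc (f : G →* K) {s : ℕ → G} {r : ℕ → K} {i j : ℕ}
    (h : ∀ k, i < k → k < j → f (s k) = r k) : f (desc s i j) = desc r i j := by
  rw [desc, desc, map_list_prod, List.map_map]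
  congr 1
  refine List.map_congr_left fun t ht => h _ ?_ ?_ <;> simp at ht <;> omega

theorem map_pureWord (f : G →* K) {s : ℕ → G} {r : ℕ → K} {i j : ℕ} (hij : i < j)
    (h : ∀ k, i ≤ k → k < j → f (s k) = r k) : f (pureWord s i j) = pureWord r i j := by
  simp only [pureWord, _root_.map_mul, _root_.map_inv, _root_.map_pow, h i le_rfl hij,
    map_desc f (fun k hk => h k hk.le)]

theorem desc_mem (S : Subgroup G) {s : ℕ → G} {i j : ℕ} (h : ∀ k, i < k → k < j → s k ∈ S) :
    desc s i j ∈ S := by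
  refine S.list_prod_mem fun x hx => ?_
  simp only [List.mem_map, List.mem_range] at hx
  obtain ⟨t, ht, rfl⟩ := hx
  exact h _ (by omega) (by omega)

theorem pureWord_mem (S : Subgroup G) {s : ℕ → G} {i j : ℕ} (hij : i < j)
    (h : ∀ k, i ≤ k → k < j → s k ∈ S) : pureWord s i j ∈ S :=
  have hd := desc_mem S fun k hk => h k (le_of_lt hk)
  S.mul_mem (S.mul_mem hd (S.pow_mem (h i le_rfl hij) 2)) (S.inv_mem hd)

theorem commute_desc {s : ℕ → G} {z : G} {i j : ℕ} (h : ∀ k, i < k → k < j → Commute z (s k)) :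
    Commute z (desc s i j) := by
  have := desc_mem (Subgroup.centralizer {z}) (s := s) (i := i) (j := j) fun k h1 h2 =>
    Subgroup.mem_centralizer_singleton_iff.2 (h k h1 h2).eq.symm
  exact (Subgroup.mem_centralizer_singleton_iff.1 this).symm

theorem commute_pureWord {s : ℕ → G} {z : G} {i j : ℕ} (hij : i < j)
    (h : ∀ k, i ≤ k → k < j → Commute z (s k)) : Commute z (pureWord s i j) := by
  have hd := commute_desc fun k hk => h k (le_of_lt hk)
  exact (hd.mul_right ((h i le_rfl hij).pow_right 2)).mul_right hd.inv_right

theorem desc_mul_desc (s : ℕ → G) {i j l : ℕ} (hij : i ≤ j) (hjl : j < l) :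
    desc s j l * desc s i (j + 1) = desc s i l := by
  induction l, hjl using Nat.le_induction with
  | base => simp [desc_of_le s (le_refl (j + 1))]
  | succ l hl ih => rw [desc_succ_right s (by omega), mul_assoc, ih, desc_succ_right s (by omega)]

theorem desc_conj_pureWord (s : ℕ → G) {i j l : ℕ} (hij : i ≤ j) (hjl : j < l) :
    desc s j l * pureWord s i (j + 1) * (desc s j l)⁻¹ = pureWord s i l := by
  rw [pureWord, pureWord, ← desc_mul_desc s hij hjl]
  group

theorem pureWord_succ (s : ℕ → G) {i j : ℕ} (hij : i < j) :
    pureWord s i (j + 1) = s j * pureWord s i j * (s j)⁻¹ := by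
  rw [pureWord, pureWord, desc_succ_right s hij]
  group

/-- The elements `s_k`, `m < k < L`, satisfy the braid relations. -/
structure IsBraid (m L : ℕ) (s : ℕ → G) : Prop where
  comm : ∀ k l, m < k → k + 2 ≤ l → l < L → Commute (s k) (s l)
  braid : ∀ k, m < k → k + 1 < L → s k * s (k + 1) * s k = s (k + 1) * s k * s (k + 1)

namespace IsBraid

variable {m L : ℕ} {s : ℕ → G}

theorem desc_mul_gen (hs : IsBraid m L s) {i j k : ℕ} (hi : m ≤ i) (hik : i < k) (hkj : k + 1 < j)
    (hj : j ≤ L) : desc s i j * s (k + 1) = s k * desc s i j := by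
  induction j, hkj using Nat.le_induction with
  | base =>
    rw [desc_succ_right s (by omega), desc_succ_right s hik]
    have h := commute_desc (s := s) (z := s (k + 1)) (i := i) (j := k) fun l h1 h2 =>
      (hs.comm l (k + 1) (by omega) (by omega) (by omega)).symm
    have hb := hs.braid k (by omega) (by omega)
    rw [mul_assoc, mul_assoc, ← h.eq, ← mul_assoc, ← mul_assoc, ← hb]
    group
  | succ j hj' ih =>
    rw [desc_succ_right s (by omega), mul_assoc, ih (by omega), ← mul_assoc, ← mul_assoc,
      (hs.comm k j (by omega) (by omega) (by omega)).eq]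

theorem commute_desc_right (hs : IsBraid m L s) {i j k : ℕ} (hk : m < k) (hik : k < i)
    (hj : j ≤ L) : Commute (s k) (desc s i j) :=
  commute_desc fun l h1 h2 => hs.comm k l hk (by omega) (by omega)

theorem commute_gen_pureWord (hs : IsBraid m L s) {i j k : ℕ} (hi : m < i) (hij : i < j)
    (hj : j ≤ L) (h : k + 1 < i ∧ m < k ∨ i < k ∧ k + 1 < j ∨ j < k ∧ k < L) :
    Commute (s k) (pureWord s i j) := by
  rcases h with h | h | h
  · exact commute_pureWord hij fun l h1 h2 => hs.comm k l (by omega) (by omega) (by omega)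
  · have h1 := hs.desc_mul_gen hi.le h.1 h.2 hj
    have h2 := ((hs.comm i (k + 1) hi (by omega) (by omega)).pow_left 2)
    rw [eq_mul_inv_of_mul_eq h1.symm, pureWord, Commute.conj_iff]
    exact h2.symm
  · exact commute_pureWord hij fun l h1 h2 => (hs.comm l k (by omega) (by omega) (by omega)).symm

theorem pureWord_mixed (hs : IsBraid m L s) {i j : ℕ} (hi : m < i) (hij : i < j) (hj : j < L) :
    pureWord s i j * s j * pureWord s i j * s j = s j * pureWord s i j * s j * pureWord s i j := by
  induction j, hij using Nat.le_induction with
  | base =>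
    have h := hs.braid i hi hj
    simp only [pureWord, desc_of_le s (le_refl (i + 1)), one_mul, inv_one, mul_one]
    generalize s i = a at *
    generalize s (i + 1) = b at *
    calc a ^ 2 * b * a ^ 2 * b = a * (a * b * a) * a * b := by simp only [pow_two, mul_assoc]
      _ = a * (b * a * b) * a * b := by rw [h]
      _ = a * b * a * (b * a * b) := by simp only [mul_assoc]
      _ = b * a * b * (a * b * a) := by rw [h]
      _ = b * a * (b * a * b) * a := by simp only [mul_assoc]
      _ = b * a ^ 2 * b * a ^ 2 := by rw [← h]; simp only [pow_two, mul_assoc]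
  | succ j hij' ih =>
    rw [pureWord_succ s hij']
    specialize ih (by omega)
    have hb := hs.braid j (by omega) hj
    have hc := commute_pureWord (s := s) (z := s (j + 1)) hij' fun k h1 h2 =>
      (hs.comm k (j + 1) (by omega) (by omega) (by omega)).symm
    generalize pureWord s i j = a at *
    generalize s j = b at *
    generalize s (j + 1) = c at *
    have hb' : b⁻¹ * c * b = c * b * c⁻¹ := by
      rw [mul_assoc, inv_mul_eq_iff_eq_mul, eq_comm, ← mul_assoc, mul_inv_eq_iff_eq_mul,
        ← mul_assoc, hb]
    have hb'' : c⁻¹ * b⁻¹ * c = b * c⁻¹ * b⁻¹ := by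
      rw [eq_mul_inv_iff_mul_eq, mul_assoc, mul_assoc, inv_mul_eq_iff_eq_mul, inv_mul_eq_iff_eq_mul,
        ← mul_assoc, ← mul_assoc, eq_mul_inv_iff_mul_eq, ← hb]
    calc b * a * b⁻¹ * c * (b * a * b⁻¹) * c = b * a * (b⁻¹ * c * b) * a * b⁻¹ * c := by
          simp only [mul_assoc]
      _ = b * (a * c) * b * (c⁻¹ * a) * b⁻¹ * c := by rw [hb']; simp only [mul_assoc]
      _ = b * c * a * b * a * (c⁻¹ * b⁻¹ * c) := by
          rw [← hc.eq, hc.inv_left.eq]; simp only [mul_assoc]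
      _ = b * c * (a * b * a * b) * c⁻¹ * b⁻¹ := by rw [hb'']; simp only [mul_assoc]
      _ = (b * c * b) * a * b * (a * c⁻¹) * b⁻¹ := by rw [ih]; simp only [mul_assoc]
      _ = c * b * (c * a) * b * (c⁻¹ * a) * b⁻¹ := by
          rw [hb, hc.inv_left.eq]; simp only [mul_assoc]
      _ = c * b * a * (c * b * c⁻¹) * a * b⁻¹ := by rw [hc.eq]; simp only [mul_assoc]
      _ = c * (b * a * b⁻¹) * c * (b * a * b⁻¹) := by rw [← hb']; simp only [mul_assoc]

theorem commute_pureWord_pureWord (hs : IsBraid m L s) {r i j : ℕ} (hr : m < r) (hri : r < i)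
    (hij : i < j) (hj : j < L) : Commute (pureWord s i j) (pureWord s r (j + 1)) := by
  obtain ⟨i, rfl⟩ : ∃ i', i = i' + 1 := ⟨i - 1, by omega⟩
  rw [← desc_conj_pureWord s (i := r) (j := i) (by omega) (show i < j + 1 by omega)]
  set D := desc s i (j + 1) with hD
  have h1 : MulAut.conj D⁻¹ (pureWord s (i + 1) j) = pureWord (fun k => s (k + 1)) (i + 1) j := by
    refine map_pureWord (MulAut.conj D⁻¹).toMonoidHom hij fun k hk hkj => ?_
    have := hs.desc_mul_gen (i := i) (j := j + 1) (k := k) (by omega) (by omega) (by omega)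
      (by omega)
    simp only [MulEquiv.toMonoidHom_eq_coe, MonoidHom.coe_coe, MulAut.conj_apply, inv_inv,
      ← hD] at this ⊢
    rw [mul_assoc, ← this, inv_mul_cancel_left]
  have h2 : Commute (MulAut.conj D⁻¹ (pureWord s (i + 1) j)) (pureWord s r (i + 1)) := by
    rw [h1]
    refine commute_pureWord (by omega) fun k hk hki => ?_
    refine (commute_pureWord (by omega) fun l hl hlj => ?_).symm
    exact hs.comm k (l + 1) (by omega) (by omega) (by omega)
  have := h2.map (MulAut.conj D).toMonoidHom
  simpa [mul_assoc] using this

end IsBraid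

end Words

section ArtinRepresentation

/-- The automorphism `y_k ↦ y_{k+1}`, `y_{k+1} ↦ y_{k+1}⁻¹ y_k y_{k+1}` of the free group. -/
def artin (k : ℕ) : MulAut (FreeGroup ℕ) :=
  MonoidHom.toMulEquiv
    (lift fun l => if l = k then of (k + 1) else
      if l = k + 1 then (of (k + 1))⁻¹ * of k * of (k + 1) else of l)
    (lift fun l => if l = k then of k * of (k + 1) * (of k)⁻¹ else
      if l = k + 1 then of k else of l)
    (by
      ext l
      simp only [MonoidHom.comp_apply, lift_apply_of, MonoidHom.id_apply]
      split_ifs <;> simp [*]; group)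
    (by
      ext l
      simp only [MonoidHom.comp_apply, lift_apply_of, MonoidHom.id_apply]
      split_ifs <;> simp [*]; group)

theorem artin_of (k l : ℕ) : artin k (of l) = if l = k then of (k + 1) else
    if l = k + 1 then (of (k + 1))⁻¹ * of k * of (k + 1) else of l := by
  simp [artin, MonoidHom.toMulEquiv]

theorem artin_self (k : ℕ) : artin k (of k) = of (k + 1) := by
  simp [artin_of]

theorem artin_succ (k : ℕ) : artin k (of (k + 1)) = (of (k + 1))⁻¹ * of k * of (k + 1) := by
  simp [artin_of]

theorem artin_of_ne {k l : ℕ} (h : l ≠ k) (h' : l ≠ k + 1) : artin k (of l) = of l := by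
  simp [artin_of, h, h']

theorem mulAut_ext {f g : MulAut (FreeGroup ℕ)} (h : ∀ l, f (of l) = g (of l)) : f = g := by
  have : f.toMonoidHom = g.toMonoidHom := FreeGroup.ext_hom _ _ h
  exact MulEquiv.toMonoidHom_injective this

theorem isBraid_artin (m L : ℕ) : IsBraid m L artin where
  comm k l _ h _ := by
    refine mulAut_ext fun p => ?_
    simp only [MulAut.mul_apply]
    by_cases h1 : p = k
    · subst h1
      simp (disch := omega) only [artin_self, artin_of_ne]
    by_cases h2 : p = k + 1
    · subst h2
      simp (disch := omega) only [artin_succ, artin_of_ne, _root_.map_mul, _root_.map_inv]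
    rw [artin_of_ne h1 h2]
    by_cases h3 : p = l
    · subst h3
      simp (disch := omega) only [artin_self, artin_of_ne]
    by_cases h4 : p = l + 1
    · subst h4
      simp (disch := omega) only [artin_succ, artin_of_ne, _root_.map_mul, _root_.map_inv]
    rw [artin_of_ne h3 h4, artin_of_ne h1 h2]
  braid k _ _ := by
    refine mulAut_ext fun p => ?_
    simp only [MulAut.mul_apply]
    have e0 : artin (k + 1) (of k) = of k := artin_of_ne (by omega) (by omega)
    have e2 : artin k (of (k + 1 + 1)) = of (k + 1 + 1) := artin_of_ne (by omega) (by omega)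
    by_cases h1 : p = k
    · subst h1
      simp only [e0, artin_self, e2]
    by_cases h2 : p = k + 1
    · subst h2
      simp only [e0, artin_self, artin_succ, e2, _root_.map_mul, _root_.map_inv]
    by_cases h3 : p = k + 1 + 1
    · subst h3
      simp only [e0, artin_self, artin_succ, e2, _root_.map_mul, _root_.map_inv]
      group
    · simp (disch := omega) only [artin_of_ne]

theorem desc_artin_of_ne {i j l : ℕ} (h : l ≤ i ∨ j < l) : desc artin i j (of l) = of l := by
  have := desc_mem (MulAction.stabilizer (MulAut (FreeGroup ℕ)) (of l)) (s := artin)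
    (i := i) (j := j) fun k hk hkj => artin_of_ne (by omega) (by omega)
  exact this

theorem desc_artin_succ {i j : ℕ} (h : i < j) : desc artin i j (of (i + 1)) = of j := by
  induction j, h using Nat.le_induction with
  | base => simp [desc_of_le]
  | succ j hj ih => rw [desc_succ_right _ (by omega), MulAut.mul_apply, ih, artin_self]

theorem pureWord_artin_of_lt {i j l : ℕ} (hij : i < j) (h : j < l) :
    pureWord artin i j (of l) = of l :=
  pureWord_mem (MulAction.stabilizer (MulAut (FreeGroup ℕ)) (of l)) (s := artin) hij
    fun _ _ _ => artin_of_ne (by omega) (by omega)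

theorem pureWord_artin_self {i j : ℕ} (hij : i < j) :
    pureWord artin i j (of j) = (of i * of j)⁻¹ * of j * (of i * of j) := by
  have h : (desc artin i j)⁻¹ (of j) = of (i + 1) := by
    rw [← desc_artin_succ hij, MulAut.inv_apply_self]
  rw [pureWord, MulAut.mul_apply, h, MulAut.mul_apply, pow_two, MulAut.mul_apply]
  simp only [artin_succ, artin_self, _root_.map_mul, _root_.map_inv, desc_artin_succ hij,
    desc_artin_of_ne (le_refl i |> Or.inl)]
  group

/-- The endomorphism of the free group killing all `y_k` except `y_1, …, y_N`. -/
def trunc (N : ℕ) : FreeGroup ℕ →* FreeGroup ℕ :=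
  lift fun k => if 1 ≤ k ∧ k ≤ N then of k else 1

theorem trunc_pureWord (N : ℕ) {i : ℕ} (hi : i ≤ N) (z : FreeGroup ℕ) :
    trunc N (pureWord artin i (N + 1) z) = trunc N z := by
  set D := desc artin i (N + 1) with hD
  have h0 : trunc N (D (of (i + 1))) = 1 := by
    rw [desc_artin_succ (by omega)]
    simp [trunc]
  have key : ((trunc N).comp D.toMonoidHom).comp (artin i ^ 2).toMonoidHom =
      (trunc N).comp D.toMonoidHom := by
    refine FreeGroup.ext_hom _ _ fun p => ?_
    simp only [pow_two, MonoidHom.comp_apply, MulEquiv.toMonoidHom_eq_coe, MonoidHom.coe_coe,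
      MulAut.mul_apply]
    by_cases h1 : p = i
    · subst h1
      simp [artin_self, artin_succ, h0]
    by_cases h2 : p = i + 1
    · subst h2
      simp [artin_self, artin_succ, h0]
    rw [artin_of_ne h1 h2, artin_of_ne h1 h2]
  have := DFunLike.congr_fun key (D⁻¹ z)
  simpa [pureWord, ← hD] using this

/-- An element commuting with `y_{N+1}` lies in the kernel of `trunc N`. -/
theorem trunc_eq_one_of_commute {N : ℕ} {w : FreeGroup ℕ} (h : Commute w (of (N + 1))) :
    trunc N w = 1 := by
  let e : Equiv.Perm (FreeGroup ℕ × Bool) := Equiv.swap (1, false) (1, true)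
  let f : FreeGroup ℕ →* Equiv.Perm (FreeGroup ℕ × Bool) :=
    lift fun k => if 1 ≤ k ∧ k ≤ N then (Equiv.mulLeft (of k)).prodCongr (Equiv.refl _) else e
  have he : ∀ p, (e p).1 = p.1 := by
    intro p
    simp only [e, Equiv.swap_apply_def]
    split_ifs with h1 h2 <;> simp [*]
  have hf : ∀ v p, (f v p).1 = trunc N v * p.1 := by
    intro v
    induction v using FreeGroup.induction_on with
    | C1 => simp
    | of k =>
      intro p
      simp only [f, trunc, lift_apply_of]
      split_ifs <;> simp [he]
    | inv_of k ih =>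
      intro p
      have := ih ((f (of k))⁻¹ p)
      rw [← Equiv.Perm.mul_apply, mul_inv_cancel, Equiv.Perm.one_apply] at this
      rw [_root_.map_inv, _root_.map_inv, this, inv_mul_cancel_left]
    | mul x y hx hy =>
      intro p
      rw [_root_.map_mul, Equiv.Perm.mul_apply, hx, hy, _root_.map_mul, mul_assoc]
  have hN : f (of (N + 1)) = e := by simp [f]
  by_contra hw
  have h1 := congrArg (fun q => q (1, false)) (h.map f).eq
  simp only [hN, Equiv.Perm.mul_apply] at h1
  have h2 : e (f w (1, false)) = f w (1, false) := by
    refine Equiv.swap_apply_of_ne_of_ne ?_ ?_ <;>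
    · intro h
      have := congrArg Prod.fst h
      rw [hf] at this
      simp at this
      exact hw this
  rw [h2] at h1
  simpa [e] using (f w).injective h1

end ArtinRepresentation

section MixedSystem

variable {G : Type*} [Group G]

/-- Elements `s_k` (`m < k < L`) and `ξ_i` (`1 ≤ i ≤ m`), the latter standing for `x_{i,m+1}`,
satisfying a reduced form of the defining relations of the mixed braid group. -/
structure IsMixed (m L : ℕ) (s ξ : ℕ → G) : Prop extends IsBraid m L s where
  comm_gen : ∀ i k, 1 ≤ i → i ≤ m → m + 1 < k → k < L → Commute (ξ i) (s k)
  mixed : ∀ i, 1 ≤ i → i ≤ m → m + 1 < L →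
    ξ i * s (m + 1) * ξ i * s (m + 1) = s (m + 1) * ξ i * s (m + 1) * ξ i
  comm_conj : ∀ i r, 1 ≤ r → r < i → i ≤ m → m + 1 < L →
    Commute (ξ i) (s (m + 1) * ξ r * (s (m + 1))⁻¹)

/-- The subgroup generated by the `ξ_i` and the `s_k` involving only the strands `1, …, N`. -/
def mixedSub (m : ℕ) (s ξ : ℕ → G) (N : ℕ) : Subgroup G :=
  Subgroup.closure ({g | ∃ i, 1 ≤ i ∧ i ≤ m ∧ m + 1 ≤ N ∧ g = ξ i} ∪
    {g | ∃ k, m < k ∧ k < N ∧ g = s k})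

/-- The `i`-th generator of the subgroup in which only the strand `N + 1` moves. -/
def lastGen (m : ℕ) (s ξ : ℕ → G) (N i : ℕ) : G :=
  if 1 ≤ i ∧ i ≤ m then desc s m (N + 1) * ξ i * (desc s m (N + 1))⁻¹ else
    if m < i ∧ i ≤ N then pureWord s i (N + 1) else 1

/-- The subgroup in which only the strand `N + 1` moves. -/
def lastSub (m : ℕ) (s ξ : ℕ → G) (N : ℕ) : Subgroup G :=
  (lift (lastGen m s ξ N)).range

theorem lastGen_mem (m : ℕ) (s ξ : ℕ → G) (N i : ℕ) :
    lastGen m s ξ N i ∈ lastSub m s ξ N := ⟨of i, by simp⟩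

theorem lastGen_of_le {m i : ℕ} (s ξ : ℕ → G) (N : ℕ) (h : 1 ≤ i) (h' : i ≤ m) :
    lastGen m s ξ N i = desc s m (N + 1) * ξ i * (desc s m (N + 1))⁻¹ := if_pos ⟨h, h'⟩

theorem lastGen_of_lt {m i N : ℕ} (s ξ : ℕ → G) (h : m < i) (h' : i ≤ N) :
    lastGen m s ξ N i = pureWord s i (N + 1) := by
  rw [lastGen, if_neg (by omega), if_pos ⟨h, h'⟩]

theorem pureWord_mem_lastSub {m i N : ℕ} (s ξ : ℕ → G) (h : m < i) (h' : i ≤ N) :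
    pureWord s i (N + 1) ∈ lastSub m s ξ N :=
  lastGen_of_lt s ξ h h' ▸ lastGen_mem m s ξ N i

theorem gen_mem_mixedSub {m k N : ℕ} (s ξ : ℕ → G) (h : m < k) (h' : k < N) :
    s k ∈ mixedSub m s ξ N := Subgroup.subset_closure (Or.inr ⟨k, h, h', rfl⟩)

theorem loop_mem_mixedSub {m i N : ℕ} (s ξ : ℕ → G) (h : 1 ≤ i) (h' : i ≤ m) (hN : m + 1 ≤ N) :
    ξ i ∈ mixedSub m s ξ N := Subgroup.subset_closure (Or.inl ⟨i, h, h', hN, rfl⟩)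

theorem mem_normalizer_lastSub {m N : ℕ} {s ξ : ℕ → G} {g : G}
    (h : ∀ i, g * lastGen m s ξ N i * g⁻¹ ∈ lastSub m s ξ N)
    (h' : ∀ i, g⁻¹ * lastGen m s ξ N i * g ∈ lastSub m s ξ N) :
    g ∈ Subgroup.normalizer (lastSub m s ξ N : Set G) := by
  have key : ∀ g : G, (∀ i, g * lastGen m s ξ N i * g⁻¹ ∈ lastSub m s ξ N) →
      ∀ u ∈ lastSub m s ξ N, g * u * g⁻¹ ∈ lastSub m s ξ N := by
    rintro g h _ ⟨w, rfl⟩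
    have : (lift (lastGen m s ξ N)).range ≤
        (lastSub m s ξ N).comap (MulAut.conj g).toMonoidHom := by
      rw [FreeGroup.range_lift_eq_closure, Subgroup.closure_le]
      rintro _ ⟨i, rfl⟩
      exact h i
    exact this ⟨w, rfl⟩
  refine Subgroup.mem_normalizer_iff.2 fun u => ⟨key g h u, fun hu => ?_⟩
  have := key g⁻¹ (by simpa using h') _ hu
  simpa [mul_assoc] using this

/-- If `b² ∈ V`, `b x b⁻¹ ∈ V` and `x b x b = b x b x`, then conjugation by `x` acts on these
two elements as conjugation by an element of `V`. -/
theorem exists_conj_eq_of_mixed {V : Subgroup G} {x b : G} (h : x * b * x * b = b * x * b * x)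
    (hb : b ^ 2 ∈ V) (hx : b * x * b⁻¹ ∈ V) : ∃ c ∈ V, Commute c x ∧
      Commute (c * x) (b ^ 2) ∧ Commute (c * x) (b * x * b⁻¹) := by
  have e1 : Commute (b * x * b * x) b := by
    rw [Commute, SemiconjBy]
    nth_rw 2 [← h]
    simp only [mul_assoc]
  have e2 : Commute (b * x * b * x) x := by
    rw [Commute, SemiconjBy]
    nth_rw 1 [← h]
    simp only [mul_assoc]
  have e3 : Commute (b * x * b) x := by
    rw [Commute, SemiconjBy, ← h]
    simp only [mul_assoc]
  refine ⟨b * x * b, ?_, e3, e1.pow_right 2, (e1.mul_right e2).mul_right e1.inv_right⟩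
  have : b * x * b = b * x * b⁻¹ * b ^ 2 := by group
  rw [this]
  exact V.mul_mem hx hb

theorem conj_mem_of_commute {V : Subgroup G} {x c y : G} (hc : c ∈ V) (hy : y ∈ V)
    (h : Commute (c * x) y) (hcx : Commute c x) : x * y * x⁻¹ ∈ V ∧ x⁻¹ * y * x ∈ V := by
  have h1 : x * y * x⁻¹ = c⁻¹ * y * c := by
    have := h.eq
    rw [mul_inv_eq_iff_eq_mul, mul_assoc, mul_assoc, eq_inv_mul_iff_mul_eq, ← mul_assoc, this]
  have h2 : x⁻¹ * y * x = c * y * c⁻¹ := by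
    have := h.eq
    rw [eq_mul_inv_iff_mul_eq, mul_assoc, mul_assoc, inv_mul_eq_iff_eq_mul, ← hcx.eq, ← this,
      hcx.eq, mul_assoc]
  rw [h1, h2]
  exact ⟨V.mul_mem (V.mul_mem (V.inv_mem hc) hy) hc, V.mul_mem (V.mul_mem hc hy) (V.inv_mem hc)⟩

theorem conj_mem_of_commute' {V : Subgroup G} {x y : G} (hy : y ∈ V) (h : Commute x y) :
    x * y * x⁻¹ ∈ V ∧ x⁻¹ * y * x ∈ V :=
  conj_mem_of_commute V.one_mem hy (by rwa [one_mul]) (Commute.one_left x)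

namespace IsMixed

variable {m L : ℕ} {s ξ : ℕ → G}

theorem loop_mem_normalizer (hs : IsMixed m L s ξ) {N i : ℕ} (hN : m + 1 ≤ N) (hL : N + 1 ≤ L)
    (hi : 1 ≤ i) (him : i ≤ m) : ξ i ∈ Subgroup.normalizer (lastSub m s ξ N : Set G) := by
  set T := desc s (m + 1) (N + 1) with hT
  set b := s (m + 1) with hb
  have hTm : desc s m (N + 1) = T * b := desc_succ_left s (by omega)
  have hξT : Commute (ξ i) T := commute_desc fun k h1 h2 =>
    hs.comm_gen i k hi him h1 (by omega)
  set V := (lastSub m s ξ N).comap (MulAut.conj T).toMonoidHom with hV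
  have memV : ∀ y, y ∈ V ↔ T * y * T⁻¹ ∈ lastSub m s ξ N := fun y => Iff.rfl
  have hbV : b ^ 2 ∈ V := by
    rw [memV]
    exact pureWord_mem_lastSub s ξ (Nat.lt_succ_self m) hN
  have hξV : ∀ r, 1 ≤ r → r ≤ m → b * ξ r * b⁻¹ ∈ V := fun r h1 h2 => by
    have := lastGen_mem m s ξ N r
    rw [lastGen_of_le s ξ N h1 h2, hTm] at this
    rw [memV]
    convert this using 1
    group
  obtain ⟨c, hc, hcx, hc1, hc2⟩ := exists_conj_eq_of_mixed (hs.mixed i hi him (by omega)) hbV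
    (hξV i hi him)
  have hcb := conj_mem_of_commute hc hbV hc1 hcx
  have key : ∀ r, ξ i * lastGen m s ξ N r * (ξ i)⁻¹ ∈ lastSub m s ξ N ∧
      (ξ i)⁻¹ * lastGen m s ξ N r * ξ i ∈ lastSub m s ξ N := by
    intro r
    have red : ∀ y, lastGen m s ξ N r = T * y * T⁻¹ →
        (ξ i * y * (ξ i)⁻¹ ∈ V ∧ (ξ i)⁻¹ * y * ξ i ∈ V) →
        ξ i * lastGen m s ξ N r * (ξ i)⁻¹ ∈ lastSub m s ξ N ∧
          (ξ i)⁻¹ * lastGen m s ξ N r * ξ i ∈ lastSub m s ξ N := by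
      rintro y hy ⟨h1, h2⟩
      rw [memV] at h1 h2
      rw [hy]
      constructor
      · convert h1 using 1
        rw [show ξ i * (T * y * T⁻¹) * (ξ i)⁻¹ = (ξ i * T) * y * (ξ i * T)⁻¹ by group, hξT.eq]
        group
      · convert h2 using 1
        rw [show (ξ i)⁻¹ * (T * y * T⁻¹) * ξ i = ((ξ i)⁻¹ * T) * y * ((ξ i)⁻¹ * T)⁻¹ by group,
          hξT.inv_left.eq]
        group
    by_cases hr : 1 ≤ r ∧ r ≤ m
    · refine red (b * ξ r * b⁻¹) (by rw [lastGen_of_le s ξ N hr.1 hr.2, hTm]; group) ?_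
      rcases lt_trichotomy r i with hri | rfl | hir
      · exact conj_mem_of_commute' (hξV r hr.1 hr.2)
          (hs.comm_conj i r hr.1 hri him (by omega))
      · exact conj_mem_of_commute hc (hξV r hr.1 hr.2) hc2 hcx
      · have h1 : Commute (ξ r) (b * ξ i * b⁻¹) := hs.comm_conj r i hi hir hr.2 (by omega)
        have hZ := hξV r hr.1 hr.2
        set Z := b * ξ r * b⁻¹ with hZdef
        have h2 : Commute (ξ i) ((b ^ 2)⁻¹ * Z * b ^ 2) := by
          have := ((Commute.conj_iff b⁻¹).2 h1).symm
          convert this using 1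
          · group
          · rw [hZdef]
            group
        have h3 := conj_mem_of_commute'
          (V.mul_mem (V.mul_mem (V.inv_mem hbV) hZ) hbV) h2
        constructor
        · have := V.mul_mem (V.mul_mem hcb.1 h3.1) (V.inv_mem hcb.1)
          convert this using 1
          group
        · have := V.mul_mem (V.mul_mem hcb.2 h3.2) (V.inv_mem hcb.2)
          convert this using 1
          group
    by_cases hr' : m < r ∧ r ≤ N
    · rcases (show m + 1 = r ∨ m + 1 < r by omega) with rfl | hlt
      · exact red (b ^ 2) (lastGen_of_lt s ξ hr'.1 hr'.2) hcb
      · refine conj_mem_of_commute' (lastGen_mem m s ξ N r) ?_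
        rw [lastGen_of_lt s ξ hr'.1 hr'.2]
        exact commute_pureWord (by omega) fun k h1 h2 =>
          hs.comm_gen i k hi him (by omega) (by omega)
    · rw [lastGen, if_neg hr, if_neg hr']
      simp
  exact mem_normalizer_lastSub (fun r => (key r).1) fun r => (key r).2

theorem gen_mem_normalizer (hs : IsMixed m L s ξ) {N k : ℕ} (hk : m < k) (hkN : k < N)
    (hL : N + 1 ≤ L) : s k ∈ Subgroup.normalizer (lastSub m s ξ N : Set G) := by
  have key : ∀ r, s k * lastGen m s ξ N r * (s k)⁻¹ ∈ lastSub m s ξ N ∧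
      (s k)⁻¹ * lastGen m s ξ N r * s k ∈ lastSub m s ξ N := by
    intro r
    by_cases hr : 1 ≤ r ∧ r ≤ m
    · refine conj_mem_of_commute' (lastGen_mem m s ξ N r) ?_
      rw [lastGen_of_le s ξ N hr.1 hr.2]
      have h1 := hs.desc_mul_gen (i := m) (j := N + 1) (k := k) le_rfl hk (by omega) hL
      rw [eq_mul_inv_of_mul_eq h1.symm, Commute.conj_iff]
      exact (hs.comm_gen r (k + 1) hr.1 hr.2 (by omega) (by omega)).symm
    by_cases hr' : m < r ∧ r ≤ N
    · have hm1 := pureWord_mem_lastSub s ξ hk hkN.le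
      have hm2 := pureWord_mem_lastSub s ξ (show m < k + 1 by omega) hkN
      set A := pureWord s k (N + 1) with hA
      set A' := pureWord s (k + 1) (N + 1) with hA'
      set T := desc s (k + 1) (N + 1) with hT
      have hTk : desc s k (N + 1) = T * s (k + 1) := desc_succ_left s (by omega)
      have hcT : Commute (s k) T := commute_desc fun l h1 h2 =>
        hs.comm k l hk (by omega) (by omega)
      have hbr := hs.braid k hk (by omega)
      have e1 : (s k)⁻¹ * A' * s k = A := by
        have h1 : (s k)⁻¹ * s (k + 1) * s k = s (k + 1) * s k * (s (k + 1))⁻¹ := by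
          rw [mul_assoc, inv_mul_eq_iff_eq_mul, ← mul_assoc, eq_mul_inv_iff_mul_eq, ← mul_assoc,
            hbr]
        calc (s k)⁻¹ * A' * s k = ((s k)⁻¹ * T) * s (k + 1) ^ 2 * (T⁻¹ * s k) := by
              rw [hA', pureWord]; simp only [mul_assoc]; rfl
          _ = T * ((s k)⁻¹ * s (k + 1) * s k) ^ 2 * T⁻¹ := by
              rw [hcT.inv_left.eq, ← hcT.inv_right.eq, pow_two, pow_two]; group
          _ = A := by rw [h1, hA, pureWord, hTk, pow_two, pow_two]; group
      have e3 : s k * A * (s k)⁻¹ = A' := by rw [← e1]; group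
      have e4 : s k * A' * (s k)⁻¹ = A'⁻¹ * A * A' := by
        have h1 : s k * s (k + 1) * (s k)⁻¹ = (s (k + 1))⁻¹ * s k * s (k + 1) := by
          rw [mul_inv_eq_iff_eq_mul, mul_assoc, mul_assoc, eq_inv_mul_iff_mul_eq, ← mul_assoc,
            ← mul_assoc, hbr]
        calc s k * A' * (s k)⁻¹ = (s k * T) * s (k + 1) ^ 2 * (T⁻¹ * (s k)⁻¹) := by
              rw [hA', pureWord]; simp only [mul_assoc]; rfl
          _ = T * (s k * s (k + 1) * (s k)⁻¹) ^ 2 * T⁻¹ := by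
              rw [hcT.eq, ← hcT.inv_inv.eq, pow_two, pow_two]; group
          _ = A'⁻¹ * A * A' := by rw [h1, hA, hA', pureWord, pureWord, hTk, ← hT]; simp only [pow_two]; group
      have e2 : (s k)⁻¹ * A * s k = A * A' * A⁻¹ := by
        calc (s k)⁻¹ * A * s k = (s k)⁻¹ * (A' * (A'⁻¹ * A * A') * A'⁻¹) * s k := by group
          _ = ((s k)⁻¹ * A' * s k) * A' * ((s k)⁻¹ * A' * s k)⁻¹ := by rw [← e4]; group
          _ = A * A' * A⁻¹ := by rw [e1]
      rw [lastGen_of_lt s ξ hr'.1 hr'.2]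
      by_cases h1 : r = k
      · subst h1
        rw [← hA, e2, e3]
        exact ⟨hm2, Subgroup.mul_mem _ (Subgroup.mul_mem _ hm1 hm2) (Subgroup.inv_mem _ hm1)⟩
      by_cases h2 : r = k + 1
      · subst h2
        rw [← hA', e1, e4]
        exact ⟨Subgroup.mul_mem _ (Subgroup.mul_mem _ (Subgroup.inv_mem _ hm2) hm1) hm2, hm1⟩
      · refine conj_mem_of_commute' (pureWord_mem_lastSub s ξ hr'.1 hr'.2) ?_
        exact hs.commute_gen_pureWord hr'.1 (by omega) hL (by omega)
    · rw [lastGen, if_neg hr, if_neg hr']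
      simp
  exact mem_normalizer_lastSub (fun r => (key r).1) fun r => (key r).2

theorem mixedSub_le_normalizer (hs : IsMixed m L s ξ) {N : ℕ} (hL : N + 1 ≤ L) :
    mixedSub m s ξ N ≤ Subgroup.normalizer (lastSub m s ξ N : Set G) := by
  rw [mixedSub, Subgroup.closure_le]
  rintro _ (⟨i, hi, him, hN, rfl⟩ | ⟨k, hk, hkN, rfl⟩)
  · exact hs.loop_mem_normalizer hN hL hi him
  · exact hs.gen_mem_normalizer hk hkN hL

/-- Every element of the subgroup on `N + 1` strands is an element moving only the last strand,
followed by one on `N` strands, followed by a coset representative. -/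
theorem exists_eq_of_mem_mixedSub (hs : IsMixed m L s ξ) {N : ℕ} (hm : m ≤ N) (hL : N + 1 ≤ L)
    {z : G} (hz : z ∈ mixedSub m s ξ (N + 1)) :
    ∃ u ∈ lastSub m s ξ N, ∃ h ∈ mixedSub m s ξ N, ∃ i, m ≤ i ∧ i ≤ N ∧
      z = u * h * desc s i (N + 1) := by
  have push : ∀ u ∈ lastSub m s ξ N, ∀ h ∈ mixedSub m s ξ N, ∀ u' ∈ lastSub m s ξ N,
      ∀ h' ∈ mixedSub m s ξ N, ∃ u'' ∈ lastSub m s ξ N, ∃ h'' ∈ mixedSub m s ξ N,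
        u * h * (u' * h') = u'' * h'' := by
    intro u hu h hh u' hu' h' hh'
    refine ⟨u * (h * u' * h⁻¹), Subgroup.mul_mem _ hu ?_, h * h', Subgroup.mul_mem _ hh hh', ?_⟩
    · exact (Subgroup.mem_normalizer_iff.1 (hs.mixedSub_le_normalizer hL hh) u').1 hu'
    · group
  -- it suffices to rewrite `desc s i (N + 1) * g` for generators `g` and their inverses
  have step : ∀ g, (∀ i, m ≤ i → i ≤ N → ∃ u' ∈ lastSub m s ξ N, ∃ h' ∈ mixedSub m s ξ N,
      ∃ i', m ≤ i' ∧ i' ≤ N ∧ desc s i (N + 1) * g = u' * h' * desc s i' (N + 1)) →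
      ∀ y, (∃ u ∈ lastSub m s ξ N, ∃ h ∈ mixedSub m s ξ N, ∃ i, m ≤ i ∧ i ≤ N ∧
        y = u * h * desc s i (N + 1)) →
      ∃ u ∈ lastSub m s ξ N, ∃ h ∈ mixedSub m s ξ N, ∃ i, m ≤ i ∧ i ≤ N ∧
        y * g = u * h * desc s i (N + 1) := by
    rintro g hg _ ⟨u, hu, h, hh, i, hi, hiN, rfl⟩
    obtain ⟨u', hu', h', hh', i', hi', hi'N, e⟩ := hg i hi hiN
    obtain ⟨u'', hu'', h'', hh'', e'⟩ := push u hu h hh u' hu' h' hh'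
    exact ⟨u'', hu'', h'', hh'', i', hi', hi'N, by rw [mul_assoc, e, ← mul_assoc, e']⟩
  have hU := (lastSub m s ξ N).one_mem
  have hH := (mixedSub m s ξ N).one_mem
  have same : ∀ g i, m ≤ i → i ≤ N → ∀ g' ∈ mixedSub m s ξ N,
      desc s i (N + 1) * g = g' * desc s i (N + 1) →
      (∃ u' ∈ lastSub m s ξ N, ∃ h' ∈ mixedSub m s ξ N,
        ∃ i', m ≤ i' ∧ i' ≤ N ∧ desc s i (N + 1) * g = u' * h' * desc s i' (N + 1)) ∧
      (∃ u' ∈ lastSub m s ξ N, ∃ h' ∈ mixedSub m s ξ N,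
        ∃ i', m ≤ i' ∧ i' ≤ N ∧ desc s i (N + 1) * g⁻¹ = u' * h' * desc s i' (N + 1)) := by
    intro g i hi hiN g' hg' e
    refine ⟨⟨1, hU, g', hg', i, hi, hiN, by rw [one_mul, e]⟩,
      ⟨1, hU, g'⁻¹, Subgroup.inv_mem _ hg', i, hi, hiN, ?_⟩⟩
    rw [one_mul, mul_inv_eq_iff_eq_mul, mul_assoc, e, inv_mul_cancel_left]
  have gens : ∀ g ∈ ({g | ∃ i, 1 ≤ i ∧ i ≤ m ∧ m + 1 ≤ N + 1 ∧ g = ξ i} ∪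
      {g | ∃ k, m < k ∧ k < N + 1 ∧ g = s k} : Set G), ∀ i, m ≤ i → i ≤ N →
      (∃ u' ∈ lastSub m s ξ N, ∃ h' ∈ mixedSub m s ξ N,
        ∃ i', m ≤ i' ∧ i' ≤ N ∧ desc s i (N + 1) * g = u' * h' * desc s i' (N + 1)) ∧
      (∃ u' ∈ lastSub m s ξ N, ∃ h' ∈ mixedSub m s ξ N,
        ∃ i', m ≤ i' ∧ i' ≤ N ∧ desc s i (N + 1) * g⁻¹ = u' * h' * desc s i' (N + 1)) := by
    rintro _ (⟨r, hr, hrm, -, rfl⟩ | ⟨k, hk, hkN, rfl⟩) i hi hiN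
    · rcases hi.eq_or_lt with rfl | hi'
      · have h := lastGen_mem m s ξ N r
        rw [lastGen_of_le s ξ N hr hrm] at h
        exact ⟨⟨_, h, 1, hH, m, le_rfl, hm, by group⟩,
          ⟨_, Subgroup.inv_mem _ h, 1, hH, m, le_rfl, hm, by group⟩⟩
      · refine same _ i hi hiN _ (loop_mem_mixedSub s ξ hr hrm (by omega)) ?_
        exact (commute_desc fun k h1 h2 => hs.comm_gen r k hr hrm (by omega) (by omega)).eq.symm
    · rcases lt_or_ge k i with h1 | h1
      · exact same _ i hi hiN _ (gen_mem_mixedSub s ξ hk (by omega))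
          (hs.commute_desc_right hk h1 hL).eq.symm
      rcases h1.eq_or_lt with rfl | h1
      · obtain ⟨i, rfl⟩ : ∃ i', i = i' + 1 := ⟨i - 1, by omega⟩
        have e := desc_succ_left s (show i + 1 < N + 1 by omega)
        have h := pureWord_mem_lastSub s ξ hk hiN
        refine ⟨⟨1, hU, 1, hH, i, by omega, by omega, by rw [e]; group⟩,
          ⟨_, Subgroup.inv_mem _ h, 1, hH, i, by omega, by omega, ?_⟩⟩
        rw [e, pureWord]
        group
      rcases (Nat.succ_le_of_lt h1).eq_or_lt with rfl | h1
      · have e := desc_succ_left s (show i + 1 < N + 1 by omega)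
        have h := pureWord_mem_lastSub s ξ hk (by omega : i + 1 ≤ N)
        refine ⟨⟨_, h, 1, hH, i + 1, by omega, by omega, ?_⟩,
          ⟨1, hU, 1, hH, i + 1, by omega, by omega, by rw [Nat.succ_eq_add_one, e]; group⟩⟩
        rw [Nat.succ_eq_add_one, e, pureWord, pow_two]
        group
      · obtain ⟨k, rfl⟩ : ∃ k', k = k' + 1 := ⟨k - 1, by omega⟩
        exact same _ i hi hiN _ (gen_mem_mixedSub s ξ (by omega) (by omega))
          (hs.desc_mul_gen hi (by omega) (by omega) hL)
  induction hz using Subgroup.closure_induction_right with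
  | one =>
    exact ⟨1, hU, 1, hH, N, hm, le_rfl, by simp [desc_of_le s (le_refl (N + 1))]⟩
  | mul_right x _ g hg ih => exact step g (fun i h1 h2 => (gens g hg i h1 h2).1) x ih
  | mul_inv_cancel x _ g hg ih => exact step g⁻¹ (fun i h1 h2 => (gens g hg i h1 h2).2) x ih

variable {Φ : G →* MulAut (FreeGroup ℕ)}

theorem map_lastGen (hΦs : ∀ k, m < k → k < L → Φ (s k) = artin k)
    (hΦξ : ∀ i, 1 ≤ i → i ≤ m → Φ (ξ i) = pureWord artin i (m + 1)) {N i : ℕ} (hm : m ≤ N)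
    (hL : N + 1 ≤ L) (hi : 1 ≤ i) (hiN : i ≤ N) :
    Φ (lastGen m s ξ N i) = pureWord artin i (N + 1) := by
  by_cases him : i ≤ m
  · rw [lastGen_of_le s ξ N hi him, _root_.map_mul, _root_.map_mul, _root_.map_inv, hΦξ i hi him,
      map_desc Φ fun k h1 h2 => hΦs k h1 (by omega)]
    exact desc_conj_pureWord artin him (by omega)
  · rw [lastGen_of_lt s ξ (by omega) hiN]
    exact map_pureWord Φ (by omega) fun k h1 h2 => hΦs k (by omega) (by omega)

theorem map_mixedSub_fixes (hΦs : ∀ k, m < k → k < L → Φ (s k) = artin k)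
    (hΦξ : ∀ i, 1 ≤ i → i ≤ m → Φ (ξ i) = pureWord artin i (m + 1)) {N : ℕ} (hL : N + 1 ≤ L)
    {h : G} (hh : h ∈ mixedSub m s ξ N) : Φ h (of (N + 1)) = of (N + 1) := by
  have : mixedSub m s ξ N ≤
      (MulAction.stabilizer (MulAut (FreeGroup ℕ)) (of (N + 1))).comap Φ := by
    rw [mixedSub, Subgroup.closure_le]
    rintro _ (⟨i, hi, him, hN, rfl⟩ | ⟨k, hk, hkN, rfl⟩)
    · change Φ (ξ i) (of (N + 1)) = _
      rw [hΦξ i hi him, pureWord_artin_of_lt (by omega) (by omega)]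
    · change Φ (s k) (of (N + 1)) = _
      rw [hΦs k hk (by omega), artin_of_ne (by omega) (by omega)]
  exact this hh

/-- A word `W` in the generators moving only the last strand conjugates `y_{N+1}` by an element
which reduces to `W` once `y_{N+1}` is killed. -/
theorem map_lift_lastGen (hΦs : ∀ k, m < k → k < L → Φ (s k) = artin k)
    (hΦξ : ∀ i, 1 ≤ i → i ≤ m → Φ (ξ i) = pureWord artin i (m + 1)) {N : ℕ} (hm : m ≤ N)
    (hL : N + 1 ≤ L) (W : FreeGroup ℕ) :
    (∀ z, trunc N (Φ (lift (lastGen m s ξ N) W) z) = trunc N z) ∧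
    ∃ w, trunc N w = trunc N W ∧
      Φ (lift (lastGen m s ξ N) W) (of (N + 1)) = w⁻¹ * of (N + 1) * w := by
  induction W using FreeGroup.induction_on with
  | C1 => exact ⟨fun z => by simp, 1, rfl, by simp⟩
  | of i =>
    rw [lift_apply_of]
    by_cases hi : 1 ≤ i ∧ i ≤ N
    · rw [map_lastGen hΦs hΦξ hm hL hi.1 hi.2]
      refine ⟨trunc_pureWord N hi.2, of i * of (N + 1), ?_, pureWord_artin_self (by omega)⟩
      simp [trunc]
    · rw [lastGen, if_neg (by omega), if_neg (by omega)]
      exact ⟨fun z => by simp, 1, by simp [trunc, hi], by simp⟩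
  | inv_of i ih =>
    obtain ⟨h1, w, hw, h2⟩ := ih
    set α := Φ (lift (lastGen m s ξ N) (of i)) with hα
    have h3 : ∀ z, trunc N (α⁻¹ z) = trunc N z := fun z => by
      rw [← h1, ← MulAut.mul_apply, mul_inv_cancel, MulAut.one_apply]
    rw [_root_.map_inv, _root_.map_inv, ← hα]
    refine ⟨h3, α⁻¹ w⁻¹, by rw [h3, _root_.map_inv, _root_.map_inv, hw], ?_⟩
    have h4 : of (N + 1) = w * α (of (N + 1)) * w⁻¹ := by rw [h2]; group
    nth_rw 1 [h4]
    simp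
  | mul x y hx hy =>
    obtain ⟨h1, w, hw, h2⟩ := hx
    obtain ⟨h1', w', hw', h2'⟩ := hy
    rw [_root_.map_mul, _root_.map_mul]
    refine ⟨fun z => by rw [MulAut.mul_apply, h1, h1'],
      w * Φ (lift (lastGen m s ξ N) x) w', by rw [_root_.map_mul, h1, hw, hw', _root_.map_mul], ?_⟩
    rw [MulAut.mul_apply, h2', _root_.map_mul, _root_.map_mul, h2, _root_.map_inv]
    group

theorem eq_one_of_map_eq_one (hs : IsMixed m L s ξ)
    (hΦs : ∀ k, m < k → k < L → Φ (s k) = artin k)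
    (hΦξ : ∀ i, 1 ≤ i → i ≤ m → Φ (ξ i) = pureWord artin i (m + 1)) {N : ℕ} (hm : m ≤ N)
    (hL : N ≤ L) : ∀ z ∈ mixedSub m s ξ N, Φ z = 1 → z = 1 := by
  induction N, hm using Nat.le_induction with
  | base =>
    intro z hz _
    have : mixedSub m s ξ m ≤ ⊥ := by
      rw [mixedSub, Subgroup.closure_le]
      rintro _ (⟨i, hi, him, hN, rfl⟩ | ⟨k, hk, hkN, rfl⟩) <;> omega
    exact this hz
  | succ N hm ih =>
    intro z hz hΦz
    obtain ⟨_, ⟨W, rfl⟩, h, hh, i, hi, hiN, rfl⟩ := hs.exists_eq_of_mem_mixedSub hm hL hz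
    obtain ⟨h1, w, hw, h2⟩ := map_lift_lastGen hΦs hΦξ hm hL W
    have hfix := map_mixedSub_fixes hΦs hΦξ hL hh
    have hdesc : Φ (desc s i (N + 1)) = desc artin i (N + 1) :=
      map_desc Φ fun k h1 h2 => hΦs k (by omega) (by omega)
    have hev : w⁻¹ * of (N + 1) * w = of (i + 1) := by
      rw [← h2]
      conv_lhs => rw [← hfix, ← desc_artin_succ (show i < N + 1 by omega), ← hdesc]
      rw [← MulAut.mul_apply, ← MulAut.mul_apply, ← _root_.map_mul, ← _root_.map_mul, hΦz,
        MulAut.one_apply]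
    obtain rfl : i = N := by
      by_contra hne
      have := congrArg (trunc N) hev
      rw [_root_.map_mul, _root_.map_mul, _root_.map_inv] at this
      simp [trunc, show i + 1 ≤ N by omega] at this
    have hcomm : Commute w (of (i + 1)) := by
      rw [Commute, SemiconjBy, ← inv_mul_eq_iff_eq_mul.1 ((mul_assoc _ _ _).symm.trans hev)]
    have hW : trunc i W = 1 := hw ▸ trunc_eq_one_of_commute hcomm
    have hlift : (lift (lastGen m s ξ i)).comp (trunc i) = lift (lastGen m s ξ i) := by
      refine FreeGroup.ext_hom _ _ fun k => ?_
      by_cases hk : 1 ≤ k ∧ k ≤ i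
      · simp [trunc, hk]
      · simp only [MonoidHom.comp_apply, trunc, lift_apply_of, if_neg hk, _root_.map_one]
        rw [lastGen, if_neg (by omega), if_neg (by omega)]
    have hu : lift (lastGen m s ξ i) W = 1 := by
      rw [← hlift, MonoidHom.comp_apply, hW, _root_.map_one]
    rw [hu, desc_of_le s le_rfl, one_mul, mul_one] at hΦz ⊢
    exact ih (by omega) h hh hΦz

end IsMixed

end MixedSystem

section BraidGroup

theorem sgen_of_mem {n k : ℕ} (h : 1 ≤ k) (h' : k ≤ n) :
    sgen n k = PresentedGroup.of ⟨k - 1, by omega⟩ := dif_pos ⟨h, h'⟩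

theorem isBraid_sgen (n : ℕ) : IsBraid 0 (n + 1) (sgen n) where
  comm k l hk hkl hl := by
    rw [sgen_of_mem hk (by omega), sgen_of_mem (by omega) (by omega)]
    have : of (⟨k - 1, by omega⟩ : Fin n) * of (⟨l - 1, by omega⟩ : Fin n) *
        (of (⟨k - 1, by omega⟩ : Fin n))⁻¹ * (of (⟨l - 1, by omega⟩ : Fin n))⁻¹ ∈ braidRels n :=
      Or.inl ⟨_, _, Or.inl (by simp only; omega), rfl⟩
    have := PresentedGroup.one_of_mem this
    rwa [_root_.map_mul, _root_.map_mul, _root_.map_mul, _root_.map_inv, _root_.map_inv,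
      mul_inv_eq_one, mul_inv_eq_iff_eq_mul] at this
  braid k hk hl := by
    rw [sgen_of_mem hk (by omega), sgen_of_mem (by omega) (by omega)]
    have : of (⟨k - 1, by omega⟩ : Fin n) * of (⟨k + 1 - 1, by omega⟩ : Fin n) *
        of (⟨k - 1, by omega⟩ : Fin n) * (of (⟨k + 1 - 1, by omega⟩ : Fin n))⁻¹ *
        (of (⟨k - 1, by omega⟩ : Fin n))⁻¹ * (of (⟨k + 1 - 1, by omega⟩ : Fin n))⁻¹ ∈ braidRels n :=
      Or.inr ⟨_, _, by simp only; omega, rfl⟩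
    have := PresentedGroup.one_of_mem this
    rwa [_root_.map_mul, _root_.map_mul, _root_.map_mul, _root_.map_mul, _root_.map_mul,
      _root_.map_inv, _root_.map_inv, mul_inv_eq_one, mul_inv_eq_iff_eq_mul,
      mul_inv_eq_iff_eq_mul] at this

/-- Artin's representation of the braid group by automorphisms of a free group. -/
def artinRep (n : ℕ) : BraidGroup n →* MulAut (FreeGroup ℕ) :=
  PresentedGroup.toGroup (f := fun k : Fin n => artin (k + 1)) <| by
    rintro _ (⟨k, l, h, rfl⟩ | ⟨k, l, h, rfl⟩)
    · simp only [_root_.map_mul, _root_.map_inv, lift_apply_of]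
      rw [mul_inv_eq_one, mul_inv_eq_iff_eq_mul]
      rcases h with h | h
      · exact (isBraid_artin 0 (n + 1)).comm _ _ (by omega) (by omega) (by omega)
      · exact ((isBraid_artin 0 (n + 1)).comm _ _ (by omega) (by omega) (by omega)).symm
    · simp only [_root_.map_mul, _root_.map_inv, lift_apply_of]
      rw [mul_inv_eq_one, mul_inv_eq_iff_eq_mul, mul_inv_eq_iff_eq_mul, h]
      exact (isBraid_artin 0 (n + 1)).braid (k + 1) (by omega) (by omega)

theorem artinRep_sgen {n k : ℕ} (h : 1 ≤ k) (h' : k ≤ n) : artinRep n (sgen n k) = artin k := by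
  rw [sgen_of_mem h h', artinRep, PresentedGroup.toGroup.of]
  simp only
  congr 1
  omega

end BraidGroup

section MixedPresentation

variable {m n : ℕ}

/-- The word `x_{ij}`, where `p = (i, j)`. -/
def wordX (m n : ℕ) (p : {p : ℕ × ℕ // 1 ≤ p.1 ∧ p.1 ≤ m ∧ m + 1 ≤ p.2 ∧ p.2 ≤ m + n}) :
    FreeGroup (MixedIdx m n) := of (Sum.inl p)

/-- The word `s_k`. -/
def wordS (m n : ℕ) (k : {k : ℕ // m + 1 ≤ k ∧ k ≤ m + n - 1}) : FreeGroup (MixedIdx m n) :=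
  of (Sum.inr k)

/-- The images of the generators: `x_{ij} ↦ a_{ij}`, `s_k ↦ σ_k`. -/
def mixedFun (m n : ℕ) : MixedIdx m n → BraidGroup (m + n - 1) :=
  Sum.elim (fun p => agen (m + n - 1) p.1.1 p.1.2) fun k => sgen (m + n - 1) k.1

theorem lift_wordX (p : {p : ℕ × ℕ // 1 ≤ p.1 ∧ p.1 ≤ m ∧ m + 1 ≤ p.2 ∧ p.2 ≤ m + n}) :
    lift (mixedFun m n) (wordX m n p) = pureWord (sgen (m + n - 1)) p.1.1 p.1.2 :=
  lift_apply_of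

theorem lift_wordS (k : {k : ℕ // m + 1 ≤ k ∧ k ≤ m + n - 1}) :
    lift (mixedFun m n) (wordS m n k) = sgen (m + n - 1) k.1 :=
  lift_apply_of

/-- The homomorphism `x_{ij} ↦ a_{ij}`, `s_k ↦ σ_k`. -/
def mixedHom (m n : ℕ) : PresentedGroup (mixedRels m n) →* BraidGroup (m + n - 1) :=
  PresentedGroup.toGroup (f := mixedFun m n) <| by
    have hs := isBraid_sgen (m + n - 1)
    rintro _ (((((⟨k, l, h, rfl⟩ | ⟨k, h, rfl⟩) | ⟨i, j, k, h, rfl⟩) | ⟨i, j, h, rfl⟩) |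
      ⟨i, j, h, rfl⟩) | ⟨i, r, j, h, rfl⟩)
    · change lift _ (wordS m n k * wordS m n l * (wordS m n k)⁻¹ * (wordS m n l)⁻¹) = 1
      simp only [_root_.map_mul, _root_.map_inv, lift_wordS]
      rw [mul_inv_eq_one, mul_inv_eq_iff_eq_mul]
      have hk := k.2
      have hl := l.2
      rcases h with h | h
      · exact hs.comm _ _ (by omega) (by omega) (by omega)
      · exact (hs.comm _ _ (by omega) (by omega) (by omega)).symm
    · change lift _ (wordS m n ⟨k, _⟩ * wordS m n ⟨k + 1, _⟩ * wordS m n ⟨k, _⟩ *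
        (wordS m n ⟨k + 1, _⟩ * wordS m n ⟨k, _⟩ * wordS m n ⟨k + 1, _⟩)⁻¹) = 1
      simp only [_root_.map_mul, _root_.map_inv, lift_wordS]
      rw [mul_inv_eq_one]
      exact hs.braid k (by omega) (by omega)
    · change lift _ ((wordS m n ⟨k, _⟩)⁻¹ * wordX m n ⟨(i, j), _⟩ * wordS m n ⟨k, _⟩ *
        (wordX m n ⟨(i, j), _⟩)⁻¹) = 1
      simp only [_root_.map_mul, _root_.map_inv, lift_wordS, lift_wordX]
      have := hs.commute_gen_pureWord (i := i) (j := j) (k := k) (by omega) (by omega) (by omega)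
        (by omega)
      rw [mul_inv_eq_one, mul_assoc, inv_mul_eq_iff_eq_mul, this.eq]
    · obtain ⟨j, rfl⟩ : ∃ j', j = j' + 1 := ⟨j - 1, by omega⟩
      change lift _ (wordX m n ⟨(i, j + 1), _⟩ *
        (wordS m n ⟨j, _⟩ * wordX m n ⟨(i, j), _⟩ * (wordS m n ⟨j, _⟩)⁻¹)⁻¹) = 1
      simp only [_root_.map_mul, _root_.map_inv, lift_wordS, lift_wordX]
      rw [mul_inv_eq_one, pureWord_succ _ (by omega)]
    · change lift _ ((wordS m n ⟨j, _⟩)⁻¹ * wordX m n ⟨(i, j), _⟩ * wordS m n ⟨j, _⟩ *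
        (wordX m n ⟨(i, j), _⟩ * wordX m n ⟨(i, j + 1), _⟩ * (wordX m n ⟨(i, j), _⟩)⁻¹)⁻¹) = 1
      simp only [_root_.map_mul, _root_.map_inv, lift_wordS, lift_wordX]
      have := hs.pureWord_mixed (i := i) (j := j) (by omega) (by omega) (by omega)
      rw [mul_inv_eq_one, pureWord_succ _ (by omega), eq_mul_inv_iff_mul_eq, mul_assoc, mul_assoc,
        inv_mul_eq_iff_eq_mul, ← mul_assoc, ← mul_assoc, ← mul_assoc, eq_mul_inv_iff_mul_eq]
      simpa only [mul_assoc] using this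
    · change lift _ (wordX m n ⟨(i, j), _⟩ * wordX m n ⟨(r, j + 1), _⟩ *
        (wordX m n ⟨(r, j + 1), _⟩ * wordX m n ⟨(i, j), _⟩)⁻¹) = 1
      simp only [_root_.map_mul, _root_.map_inv, lift_wordX]
      rw [mul_inv_eq_one]
      exact hs.commute_pureWord_pureWord (by omega) (by omega) (by omega) (by omega)

/-- The generator `s_k` of the presented group, with value `1` out of range. -/
def mixedS (m n k : ℕ) : PresentedGroup (mixedRels m n) :=
  if h : m + 1 ≤ k ∧ k ≤ m + n - 1 then PresentedGroup.mk _ (wordS m n ⟨k, h⟩) else 1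

/-- The generator `x_{ij}` of the presented group, with value `1` out of range. -/
def mixedX (m n i j : ℕ) : PresentedGroup (mixedRels m n) :=
  if h : 1 ≤ i ∧ i ≤ m ∧ m + 1 ≤ j ∧ j ≤ m + n then
    PresentedGroup.mk _ (wordX m n ⟨(i, j), h⟩) else 1

theorem mixedS_of_mem {k : ℕ} (h : m + 1 ≤ k ∧ k ≤ m + n - 1) :
    mixedS m n k = PresentedGroup.mk _ (wordS m n ⟨k, h⟩) := dif_pos h

theorem mixedX_of_mem {i j : ℕ} (h : 1 ≤ i ∧ i ≤ m ∧ m + 1 ≤ j ∧ j ≤ m + n) :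
    mixedX m n i j = PresentedGroup.mk _ (wordX m n ⟨(i, j), h⟩) := dif_pos h

theorem mixedHom_of_inl
    (p : {p : ℕ × ℕ // 1 ≤ p.1 ∧ p.1 ≤ m ∧ m + 1 ≤ p.2 ∧ p.2 ≤ m + n}) :
    mixedHom m n (PresentedGroup.of (Sum.inl p)) = agen (m + n - 1) p.1.1 p.1.2 :=
  PresentedGroup.toGroup.of _

theorem mixedHom_of_inr (k : {k : ℕ // m + 1 ≤ k ∧ k ≤ m + n - 1}) :
    mixedHom m n (PresentedGroup.of (Sum.inr k)) = sgen (m + n - 1) k.1 :=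
  PresentedGroup.toGroup.of _

theorem mixedX_succ {i j : ℕ} (hi : 1 ≤ i) (him : i ≤ m) (hj : m + 1 ≤ j) (hjn : j < m + n) :
    mixedX m n i (j + 1) = mixedS m n j * mixedX m n i j * (mixedS m n j)⁻¹ := by
  rw [mixedX_of_mem ⟨hi, him, by omega, by omega⟩, mixedX_of_mem ⟨hi, him, by omega, by omega⟩,
    mixedS_of_mem ⟨by omega, by omega⟩, ← mul_inv_eq_one]
  simp only [← _root_.map_mul, ← _root_.map_inv]
  exact PresentedGroup.one_of_mem (Or.inl (Or.inl (Or.inr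
    ⟨i, j + 1, ⟨hi, him, by omega, by omega⟩, rfl⟩)))

theorem isMixed_mixedRels (m n : ℕ) :
    IsMixed m (m + n) (mixedS m n) fun i => mixedX m n i (m + 1) where
  comm k l hk hkl hl := by
    rw [Commute, SemiconjBy, ← mul_inv_eq_iff_eq_mul, ← mul_inv_eq_one,
      mixedS_of_mem (by omega), mixedS_of_mem (by omega)]
    simp only [← _root_.map_mul, ← _root_.map_inv]
    exact PresentedGroup.one_of_mem (Or.inl (Or.inl (Or.inl (Or.inl (Or.inl
      ⟨⟨k, by omega⟩, ⟨l, by omega⟩, Or.inl (by simp only; omega), rfl⟩)))))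
  braid k hk hl := by
    rw [← mul_inv_eq_one, mixedS_of_mem (by omega), mixedS_of_mem (by omega)]
    simp only [← _root_.map_mul, ← _root_.map_inv]
    exact PresentedGroup.one_of_mem (Or.inl (Or.inl (Or.inl (Or.inl (Or.inr
      ⟨k, by omega, rfl⟩)))))
  comm_gen i k hi him hk hkL := by
    have h : (mixedS m n k)⁻¹ * mixedX m n i (m + 1) * mixedS m n k * (mixedX m n i (m + 1))⁻¹ =
        1 := by
      rw [mixedS_of_mem (by omega), mixedX_of_mem (by omega)]
      simp only [← _root_.map_mul, ← _root_.map_inv]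
      exact PresentedGroup.one_of_mem (Or.inl (Or.inl (Or.inl (Or.inr
        ⟨i, m + 1, k, ⟨by omega, by omega⟩, rfl⟩))))
    rwa [mul_inv_eq_one, mul_assoc, inv_mul_eq_iff_eq_mul] at h
  mixed i hi him hL := by
    have h : (mixedS m n (m + 1))⁻¹ * mixedX m n i (m + 1) * mixedS m n (m + 1) *
        (mixedX m n i (m + 1) * mixedX m n i (m + 1 + 1) * (mixedX m n i (m + 1))⁻¹)⁻¹ = 1 := by
      rw [mixedS_of_mem (by omega), mixedX_of_mem (by omega), mixedX_of_mem (by omega)]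
      simp only [← _root_.map_mul, ← _root_.map_inv]
      exact PresentedGroup.one_of_mem (Or.inl (Or.inr ⟨i, m + 1, by omega, rfl⟩))
    rw [mul_inv_eq_one, mixedX_succ hi him le_rfl hL, eq_mul_inv_iff_mul_eq, mul_assoc, mul_assoc,
      inv_mul_eq_iff_eq_mul, ← mul_assoc, ← mul_assoc, ← mul_assoc, eq_mul_inv_iff_mul_eq] at h
    simpa only [mul_assoc] using h
  comm_conj i r hr hri him hL := by
    rw [← mixedX_succ hr (by omega) le_rfl hL, Commute, SemiconjBy, ← mul_inv_eq_one,
      mixedX_of_mem (by omega), mixedX_of_mem (by omega)]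
    simp only [← _root_.map_mul, ← _root_.map_inv]
    exact PresentedGroup.one_of_mem (Or.inr ⟨i, r, m + 1, by omega, rfl⟩)

theorem mixedSub_eq_top (m n : ℕ) :
    mixedSub m (mixedS m n) (fun i => mixedX m n i (m + 1)) (m + n) = ⊤ := by
  rw [eq_top_iff, ← PresentedGroup.closure_range_of, Subgroup.closure_le]
  rintro _ ⟨⟨⟨i, j⟩, h⟩ | ⟨k, hk⟩, rfl⟩
  · change PresentedGroup.mk _ (wordX m n _) ∈ _
    rw [← mixedX_of_mem h]
    obtain ⟨hi, him, hj, hjn⟩ := h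
    simp only at hi him hj hjn
    induction j, hj using Nat.le_induction with
    | base => exact loop_mem_mixedSub _ (fun i => mixedX m n i (m + 1)) hi him hjn
    | succ j hj ih =>
      have hS := gen_mem_mixedSub (mixedS m n) (fun i => mixedX m n i (m + 1))
        (show m < j by omega) (show j < m + n by omega)
      rw [mixedX_succ hi him hj (by omega)]
      exact Subgroup.mul_mem _ (Subgroup.mul_mem _ hS (ih (by omega))) (Subgroup.inv_mem _ hS)
  · change PresentedGroup.mk _ (wordS m n _) ∈ _
    rw [← mixedS_of_mem hk]
    exact gen_mem_mixedSub _ _ (by omega) (by omega)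

theorem mixedHom_mixedS {k : ℕ} (h : m < k) (h' : k < m + n) :
    mixedHom m n (mixedS m n k) = sgen (m + n - 1) k := by
  rw [mixedS_of_mem (by omega)]
  exact mixedHom_of_inr _

theorem mixedHom_mixedX {i j : ℕ} (h : 1 ≤ i ∧ i ≤ m ∧ m + 1 ≤ j ∧ j ≤ m + n) :
    mixedHom m n (mixedX m n i j) = agen (m + n - 1) i j := by
  rw [mixedX_of_mem h]
  exact mixedHom_of_inl _

theorem mixedHom_injective (hn : 1 ≤ n) : Function.Injective (mixedHom m n) := by
  refine (injective_iff_map_eq_one _).2 fun z hz => ?_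
  refine (isMixed_mixedRels m n).eq_one_of_map_eq_one
    (Φ := (artinRep (m + n - 1)).comp (mixedHom m n)) (fun k h h' => ?_) (fun i h h' => ?_)
    (N := m + n) (by omega) le_rfl z (mixedSub_eq_top m n ▸ Subgroup.mem_top z) ?_
  · rw [MonoidHom.comp_apply, mixedHom_mixedS h h', artinRep_sgen (by omega) (by omega)]
  · rw [MonoidHom.comp_apply, mixedHom_mixedX ⟨h, h', le_rfl, by omega⟩]
    exact map_pureWord (s := sgen (m + n - 1)) _ (by omega) fun k h1 h2 =>
      artinRep_sgen (by omega) (by omega)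
  · rw [MonoidHom.comp_apply, hz, _root_.map_one]

theorem range_mixedHom (m n : ℕ) : (mixedHom m n).range = Bmn m n := by
  have hS : ∀ k, m < k → k < m + n → sgen (m + n - 1) k ∈ (mixedHom m n).range :=
    fun k h h' => ⟨mixedS m n k, mixedHom_mixedS h h'⟩
  apply le_antisymm
  · rw [MonoidHom.range_eq_map, ← PresentedGroup.closure_range_of, MonoidHom.map_closure,
      Subgroup.closure_le]
    rintro _ ⟨_, ⟨⟨⟨i, j⟩, h⟩ | ⟨k, hk⟩, rfl⟩, rfl⟩
    · rw [mixedHom_of_inl]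
      obtain ⟨hi, him, hj, hjn⟩ := h
      exact Subgroup.subset_closure (Or.inl ⟨i, j, hi, by simp only at *; omega, hj, hjn, rfl⟩)
    · rw [mixedHom_of_inr]
      exact Subgroup.subset_closure (Or.inr ⟨k, hk.1, hk.2, rfl⟩)
  · rw [Bmn, Subgroup.closure_le]
    rintro _ (⟨i, j, hi, hij, hj, hjn, rfl⟩ | ⟨k, hk, hkn, rfl⟩)
    · by_cases him : i ≤ m
      · exact ⟨mixedX m n i j, mixedHom_mixedX ⟨hi, him, hj, hjn⟩⟩
      · exact pureWord_mem _ hij fun k h1 h2 => hS k (by omega) (by omega)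
    · exact hS k hk (by omega)

end MixedPresentation

/-- Theorem 2: the group presented by the generators `x_{ij}, s_k` and the relations
Σ1, Σ2, (1)–(4) is isomorphic to `B_{m,n}`, via `x_{ij} ↦ a_{ij}` and `s_k ↦ σ_k`. -/
theorem statement16 (m n : ℕ) (hm : 1 ≤ m) (hn : 1 ≤ n) :
    ∃ φ : PresentedGroup (mixedRels m n) ≃* ↥(Bmn m n),
      (∀ p : {p : ℕ × ℕ // 1 ≤ p.1 ∧ p.1 ≤ m ∧ m + 1 ≤ p.2 ∧ p.2 ≤ m + n},
        (φ (PresentedGroup.of (Sum.inl p)) : BraidGroup (m + n - 1)) =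
          agen (m + n - 1) p.1.1 p.1.2) ∧
      (∀ k : {k : ℕ // m + 1 ≤ k ∧ k ≤ m + n - 1},
        (φ (PresentedGroup.of (Sum.inr k)) : BraidGroup (m + n - 1)) =
          sgen (m + n - 1) k.1) := by
  refine ⟨(MonoidHom.ofInjective (mixedHom_injective hn)).trans
    (MulEquiv.subgroupCongr (range_mixedHom m n)), mixedHom_of_inl, mixedHom_of_inr⟩

end BraidPaper
end
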